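/- arXiv:2302.00035 — 6 statements merged into one kernel-verified Lean document; each statement's English description precedes it below -/
import Mathlib

section
/- Let (R, m) be a commutative Noetherian local ring, and let M be a finitely generated R-module with positive depth. Let N be a finitely generated R-module with Tor_1^R(M, N) = 0. Then depth(M ⊗_R N) > 0 if and only if there exists an element x ∈ m that is regular on M such that Tor_1^R(M/xM, N) = 0. -/
open CategoryTheory

universe u

/-- `Tor_i` over `R`, for bundled modules. -/
noncomputable def torM (R : Type u) [CommRing R] (i : ℕ) (M N : ModuleCat.{u} R) :
    ModuleCat.{u} R :=
  ((Tor (ModuleCat.{u} R) i).obj M).obj N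

/-- `Tor_i^R(M, N)` for unbundled modules. -/
noncomputable def torMod (R : Type u) [CommRing R] (i : ℕ)
    (M N : Type u) [AddCommGroup M] [Module R M] [AddCommGroup N] [Module R N] :
    ModuleCat.{u} R :=
  torM R i (ModuleCat.of R M) (ModuleCat.of R N)

/-- `M` and `N` are Tor-independent over `R`: `Tor_i^R(M,N) = 0` for all `i ≥ 1`. -/
def TorIndep (R : Type u) [CommRing R]
    (M N : Type u) [AddCommGroup M] [Module R M] [AddCommGroup N] [Module R N] : Prop :=
  ∀ i : ℕ, 1 ≤ i → Subsingleton (torMod R i M N)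

/-- `Ext^i_R(M, N)` for unbundled modules. -/
noncomputable def extMod (R : Type u) [CommRing R] (i : ℕ)
    (M N : Type u) [AddCommGroup M] [Module R M] [AddCommGroup N] [Module R N] :
    ModuleCat.{u} R :=
  ((Ext R (ModuleCat.{u} R) i).obj (Opposite.op (ModuleCat.of R M))).obj (ModuleCat.of R N)

/-- Depth of a module over a local ring: the least `i` with `Ext^i(k, M) ≠ 0`
(and `⊤` if all such Ext vanish, e.g. for the zero module). -/
noncomputable def eDepth (R : Type u) [CommRing R] [IsLocalRing R]
    (M : Type u) [AddCommGroup M] [Module R M] : ℕ∞ :=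
  sInf {n : ℕ∞ | ∃ i : ℕ, n = (i : ℕ∞) ∧
    Nontrivial (extMod R i (IsLocalRing.ResidueField R) M)}

open Limits in
theorem preservesFiniteColimits_linearYoneda_rightOp (R : Type u) [CommRing R]
    (M : ModuleCat.{u} R) :
    PreservesFiniteColimits (((linearYoneda R (ModuleCat.{u} R)).obj M).rightOp) := by
  have : PreservesLimits (((linearYoneda R (ModuleCat.{u} R)).obj M) ⋙ forget _) :=
    inferInstanceAs (PreservesLimits (yoneda.obj M))
  have : PreservesLimits ((linearYoneda R (ModuleCat.{u} R)).obj M) :=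
    preservesLimits_of_reflects_of_preserves _ (forget _)
  apply preservesFiniteColimits_rightOp

theorem extMod_zero_subsingleton_iff (R : Type u) [CommRing R]
    (M N : Type u) [AddCommGroup M] [Module R M] [AddCommGroup N] [Module R N] :
    Subsingleton (extMod R 0 M N) ↔ Subsingleton (M →ₗ[R] N) := by
  have := preservesFiniteColimits_linearYoneda_rightOp R (ModuleCat.of R N)
  have e := ((((linearYoneda R (ModuleCat.{u} R)).obj
    (ModuleCat.of R N)).rightOp.leftDerivedZeroIsoSelf).app (ModuleCat.of R M)).unop
  have e' : (M →ₗ[R] N) ≃ extMod R 0 M N :=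
    ModuleCat.homEquiv.symm.trans (e.toLinearEquiv.toEquiv)
  exact e'.subsingleton_congr.symm

theorem torMod_one_subsingleton_iff (R : Type u) [CommRing R]
    (M N : Type u) [AddCommGroup M] [Module R M] [AddCommGroup N] [Module R N]
    (P : ProjectiveResolution (ModuleCat.of R N)) :
    Subsingleton (torMod R 1 M N) ↔
      Function.Exact ((P.complex.d 2 1).hom.lTensor M) ((P.complex.d 1 0).hom.lTensor M) := by
  have e := P.isoLeftDerivedObj
    ((MonoidalCategory.tensoringLeft (ModuleCat.{u} R)).obj (ModuleCat.of R M)) 1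
  rw [← ModuleCat.isZero_iff_subsingleton]
  refine e.isZero_iff.trans ?_
  refine (HomologicalComplex.exactAt_iff_isZero_homology _ _).symm.trans ?_
  rw [HomologicalComplex.exactAt_iff' _ 2 1 0 (by simp) (by simp),
    ShortComplex.ShortExact.moduleCat_exact_iff_function_exact]
  rfl

theorem eDepth_pos_iff_subsingleton_linearMap (R : Type u) [CommRing R] [IsLocalRing R]
    (M : Type u) [AddCommGroup M] [Module R M] :
    0 < eDepth R M ↔ Subsingleton (IsLocalRing.ResidueField R →ₗ[R] M) := by
  rw [← extMod_zero_subsingleton_iff, pos_iff_ne_zero, ← not_nontrivial_iff_subsingleton, eDepth,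
    Ne, ENat.sInf_eq_zero]
  simp [eq_comm (a := (0 : ℕ∞))]

theorem eDepth_pos_iff (R : Type u) [CommRing R] [IsNoetherianRing R] [IsLocalRing R]
    (M : Type u) [AddCommGroup M] [Module R M] [Module.Finite R M] :
    0 < eDepth R M ↔ ∃ x ∈ IsLocalRing.maximalIdeal R, IsSMulRegular M x := by
  rw [eDepth_pos_iff_subsingleton_linearMap, IsSMulRegular.subsingleton_linearMap_iff]
  have : Module.annihilator R (IsLocalRing.ResidueField R) = IsLocalRing.maximalIdeal R :=
    Ideal.annihilator_quotient
  rw [this]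

theorem exists_isSMulRegular_and_of_eDepth_pos (R : Type u) [CommRing R] [IsNoetherianRing R]
    [IsLocalRing R] (M N : Type u) [AddCommGroup M] [Module R M] [Module.Finite R M]
    [AddCommGroup N] [Module R N] [Module.Finite R N]
    (hM : 0 < eDepth R M) (hN : 0 < eDepth R N) :
    ∃ x ∈ IsLocalRing.maximalIdeal R, IsSMulRegular M x ∧ IsSMulRegular N x := by
  have h : 0 < eDepth R (M × N) := by
    rw [eDepth_pos_iff_subsingleton_linearMap] at *
    exact (LinearMap.prodEquiv R (M := IsLocalRing.ResidueField R)).symm.subsingleton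
  obtain ⟨x, hx, hr⟩ := (eDepth_pos_iff R (M × N)).mp h
  refine ⟨x, hx, fun a b hab => ?_, fun a b hab => ?_⟩
  · exact congrArg Prod.fst (@hr (a, 0) (b, 0) (by simpa using hab))
  · exact congrArg Prod.snd (@hr (0, a) (0, b) (by simpa using hab))

open TensorProduct in
/-- The kernel of `M ⊗ P → (M / xM) ⊗ P` consists of the multiples of `x`. -/
theorem rTensor_mkQ_eq_zero_iff {R : Type*} [CommRing R] {M P : Type*}
    [AddCommGroup M] [Module R M] [AddCommGroup P] [Module R P] {x : R} {z : M ⊗[R] P} :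
    (Ideal.span {x} • ⊤ : Submodule R M).mkQ.rTensor P z = 0 ↔
      ∃ w : M ⊗[R] P, x • w = z := by
  have hex : Function.Exact (LinearMap.lsmul R M x)
      (Ideal.span {x} • ⊤ : Submodule R M).mkQ := by
    rw [LinearMap.exact_iff, Submodule.ker_mkQ, Submodule.ideal_span_singleton_smul]
    ext m
    simp [Submodule.mem_smul_pointwise_iff_exists]
  have h : (LinearMap.lsmul R M x).rTensor P = LinearMap.lsmul R (M ⊗[R] P) x := by
    ext; simp [TensorProduct.smul_tmul']
  rw [rTensor_exact P hex (Submodule.mkQ_surjective _) z, h]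
  rfl

open TensorProduct in
theorem exact_lTensor_quotient_iff_isSMulRegular {R : Type*} [CommRing R]
    {M N P₀ P₁ P₂ : Type*} [AddCommGroup M] [Module R M] [AddCommGroup N] [Module R N]
    [AddCommGroup P₀] [Module R P₀] [Module.Flat R P₀] [AddCommGroup P₁] [Module R P₁]
    [AddCommGroup P₂] [Module R P₂] {d₂ : P₂ →ₗ[R] P₁} {d₁ : P₁ →ₗ[R] P₀} {ε : P₀ →ₗ[R] N}
    (hε : Function.Exact d₁ ε) (hε' : Function.Surjective ε)
    (hM : Function.Exact (d₂.lTensor M) (d₁.lTensor M)) {x : R} (hx : IsSMulRegular M x) :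
    Function.Exact (d₂.lTensor (M ⧸ (Ideal.span {x} • ⊤ : Submodule R M)))
      (d₁.lTensor (M ⧸ (Ideal.span {x} • ⊤ : Submodule R M))) ↔
      IsSMulRegular (M ⊗[R] N) x := by
  set I : Submodule R M := Ideal.span {x} • ⊤
  have hexN := lTensor_exact M hε hε'
  have hxP : IsSMulRegular (M ⊗[R] P₀) x := hx.rTensor P₀
  have hq₁ : Function.Surjective (I.mkQ.rTensor P₁) :=
    LinearMap.rTensor_surjective P₁ I.mkQ_surjective
  have hq₂ : Function.Surjective (I.mkQ.rTensor P₂) :=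
    LinearMap.rTensor_surjective P₂ I.mkQ_surjective
  have hc₁ (z : M ⊗[R] P₁) : d₁.lTensor (M ⧸ I) (I.mkQ.rTensor P₁ z) =
      I.mkQ.rTensor P₀ (d₁.lTensor M z) := by
    simp only [← LinearMap.comp_apply, LinearMap.lTensor_comp_rTensor,
      LinearMap.rTensor_comp_lTensor]
  have hc₂ (z : M ⊗[R] P₂) : d₂.lTensor (M ⧸ I) (I.mkQ.rTensor P₂ z) =
      I.mkQ.rTensor P₁ (d₂.lTensor M z) := by
    simp only [← LinearMap.comp_apply, LinearMap.lTensor_comp_rTensor,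
      LinearMap.rTensor_comp_lTensor]
  constructor
  · intro h
    rw [isSMulRegular_iff_right_eq_zero_of_smul]
    intro t ht
    obtain ⟨w, rfl⟩ := LinearMap.lTensor_surjective M hε' t
    rw [← map_smul] at ht
    obtain ⟨z, hz⟩ := (hexN _).mp ht
    have hz' : d₁.lTensor (M ⧸ I) (I.mkQ.rTensor P₁ z) = 0 := by
      rw [hc₁, hz]
      exact rTensor_mkQ_eq_zero_iff.mpr ⟨w, rfl⟩
    obtain ⟨y, hy⟩ := (h _).mp hz'
    obtain ⟨u, rfl⟩ := hq₂ y
    rw [hc₂, ← sub_eq_zero, ← map_sub] at hy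
    obtain ⟨v, hv⟩ := rTensor_mkQ_eq_zero_iff.mp hy
    refine (hexN w).mpr ⟨-v, hxP ?_⟩
    simp only
    rw [← map_smul, smul_neg, hv, neg_sub, map_sub, hM.apply_apply_eq_zero, sub_zero, hz]
  · intro h y
    constructor
    · intro hy
      obtain ⟨z, rfl⟩ := hq₁ y
      rw [hc₁] at hy
      obtain ⟨w, hw⟩ := rTensor_mkQ_eq_zero_iff.mp hy
      have hw' : ε.lTensor M w = 0 := by
        refine h.right_eq_zero_of_smul ?_
        rw [← map_smul, hw, hexN.apply_apply_eq_zero]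
      obtain ⟨v, rfl⟩ := (hexN w).mp hw'
      have hzv : d₁.lTensor M (z - x • v) = 0 := by
        rw [map_sub, map_smul, hw, sub_self]
      obtain ⟨u, hu⟩ := (hM _).mp hzv
      refine ⟨I.mkQ.rTensor P₂ u, ?_⟩
      rw [hc₂, hu, map_sub, rTensor_mkQ_eq_zero_iff.mpr ⟨v, rfl⟩, sub_zero]
    · rintro ⟨u, rfl⟩
      obtain ⟨u, rfl⟩ := hq₂ u
      rw [hc₂, hc₁, hM.apply_apply_eq_zero, map_zero]

theorem torMod_quotient_subsingleton_iff_isSMulRegular (R : Type u) [CommRing R]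
    (M N : Type u) [AddCommGroup M] [Module R M] [AddCommGroup N] [Module R N]
    (h1 : Subsingleton (torMod R 1 M N)) {x : R} (hx : IsSMulRegular M x) :
    Subsingleton (torMod R 1 (M ⧸ (Ideal.span {x} • ⊤ : Submodule R M)) N) ↔
      IsSMulRegular (TensorProduct R M N) x := by
  let P : ProjectiveResolution (ModuleCat.of R N) := projectiveResolution _
  have : Module.Projective R (P.complex.X 0) :=
    (IsProjective.iff_projective (P.complex.X 0)).mpr (P.projective 0)
  rw [torMod_one_subsingleton_iff R _ N P] at h1 ⊢
  exact exact_lTensor_quotient_iff_isSMulRegular (ε := (P.π.f 0).hom)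
    ((ShortComplex.ShortExact.moduleCat_exact_iff_function_exact _).mp P.exact₀)
    ((ModuleCat.epi_iff_surjective (P.π.f 0)).mp inferInstance) h1 hx

/-- `depth (M ⊗_R N) > 0` iff `Tor_1^R(M/xM, N) = 0` for some `x ∈ m`
regular on `M`, given `depth M > 0` and `Tor_1^R(M,N) = 0`. -/
theorem stmt_0 (R : Type u) [CommRing R] [IsNoetherianRing R] [IsLocalRing R]
    (M N : Type u) [AddCommGroup M] [Module R M] [AddCommGroup N] [Module R N]
    [Module.Finite R M] [Module.Finite R N]
    (hM : 0 < eDepth R M) (h1 : Subsingleton (torMod R 1 M N)) :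
    0 < eDepth R (TensorProduct R M N) ↔
      ∃ x ∈ IsLocalRing.maximalIdeal R, IsSMulRegular M x ∧
        Subsingleton (torMod R 1 (M ⧸ (Ideal.span {x} • ⊤ : Submodule R M)) N) := by
  constructor
  · intro hMN
    obtain ⟨x, hx, hxM, hxMN⟩ := exists_isSMulRegular_and_of_eDepth_pos R M _ hM hMN
    exact ⟨x, hx, hxM,
      (torMod_quotient_subsingleton_iff_isSMulRegular R M N h1 hxM).mpr hxMN⟩
  · rintro ⟨x, hx, hxM, h⟩
    exact (eDepth_pos_iff R _).mpr
      ⟨x, hx, (torMod_quotient_subsingleton_iff_isSMulRegular R M N h1 hxM).mp h⟩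
end

section
/- Let (R, m) be a commutative Noetherian local ring with positive depth, let M and N be nonzero finitely generated R-modules that are Tor-independent (Tor_i^R(M,N)=0 for all i ≥ 1), and let x ∈ m be regular on R, M, and N. Then Tor_p^{R/xR}(M/xM, N/xN) = 0 for all p ≥ 2, and Tor_1^{R/xR}(M/xM, N/xN) ≅ Tor_1^R(M/xM, N). -/
open CategoryTheory

universe u

open TensorProduct MonoidalCategory

/-- If the bottom row is the quotient of the top row by a scalar `x` that is regular on the last
module, then exactness of the top row at two consecutive spots gives exactness of the bottom row. -/
theorem Function.Exact.of_regular_quotient {R : Type*} [CommRing R] {x : R}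
    {C₂ C₁ C₀ C D₂ D₁ D₀ : Type*}
    [AddCommGroup C₂] [Module R C₂] [AddCommGroup C₁] [Module R C₁] [AddCommGroup C₀] [Module R C₀]
    [AddCommGroup C] [Module R C] [AddCommGroup D₂] [Module R D₂] [AddCommGroup D₁] [Module R D₁]
    [AddCommGroup D₀] [Module R D₀]
    {d₂ : C₂ →ₗ[R] C₁} {d₁ : C₁ →ₗ[R] C₀} {d₀ : C₀ →ₗ[R] C}
    {δ₂ : D₂ →ₗ[R] D₁} {δ₁ : D₁ →ₗ[R] D₀}
    {q₂ : C₂ →ₗ[R] D₂} {q₁ : C₁ →ₗ[R] D₁} {q₀ : C₀ →ₗ[R] D₀}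
    (h₁ : Function.Exact d₂ d₁) (h₀ : Function.Exact d₁ d₀) (hx : IsSMulRegular C x)
    (comm₂ : δ₂ ∘ₗ q₂ = q₁ ∘ₗ d₂) (comm₁ : δ₁ ∘ₗ q₁ = q₀ ∘ₗ d₁)
    (hq₂ : Function.Surjective q₂) (hq₁ : Function.Surjective q₁)
    (hxq₁ : ∀ c, q₁ (x • c) = 0) (hxq₀ : Function.Exact (fun c : C₀ ↦ x • c) q₀) :
    Function.Exact δ₂ δ₁ := by
  have comm₂ c : δ₂ (q₂ c) = q₁ (d₂ c) := LinearMap.congr_fun comm₂ c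
  have comm₁ c : δ₁ (q₁ c) = q₀ (d₁ c) := LinearMap.congr_fun comm₁ c
  refine fun y ↦ ⟨fun hy ↦ ?_, ?_⟩
  · obtain ⟨c, rfl⟩ := hq₁ y
    rw [comm₁] at hy
    obtain ⟨c', hc'⟩ := (hxq₀ _).1 hy
    have h : d₀ c' = 0 := hx.right_eq_zero_of_smul <| by
      rw [← map_smul]
      exact (congrArg d₀ hc').trans (h₀.apply_apply_eq_zero c)
    obtain ⟨e, rfl⟩ := (h₀ _).1 h
    obtain ⟨f, hf⟩ := (h₁ (c - x • e)).1 (by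
      rw [map_sub, map_smul, ← hc', sub_self])
    exact ⟨q₂ f, by rw [comm₂, hf, map_sub, hxq₁, sub_zero]⟩
  · rintro ⟨z, rfl⟩
    obtain ⟨c, rfl⟩ := hq₂ z
    rw [comm₂, comm₁, h₁.apply_apply_eq_zero, map_zero]

section

variable {R : Type u} [CommRing R]

theorem CategoryTheory.ProjectiveResolution.exact_succ_linearMap {X : ModuleCat.{u} R}
    (P : ProjectiveResolution X) (i : ℕ) :
    Function.Exact (P.complex.d (i + 2) (i + 1)).hom (P.complex.d (i + 1) i).hom :=
  (ShortComplex.ShortExact.moduleCat_exact_iff_function_exact _).1 (P.exact_succ i)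

theorem CategoryTheory.ProjectiveResolution.exact_zero_linearMap {X : ModuleCat.{u} R}
    (P : ProjectiveResolution X) :
    Function.Exact (P.complex.d 1 0).hom (P.π.f 0).hom :=
  (ShortComplex.ShortExact.moduleCat_exact_iff_function_exact _).1 P.exact₀

theorem CategoryTheory.ProjectiveResolution.surjective_π {X : ModuleCat.{u} R}
    (P : ProjectiveResolution X) : Function.Surjective (P.π.f 0).hom :=
  (ModuleCat.epi_iff_surjective (P.π.f 0)).1 inferInstance

instance {X : ModuleCat.{u} R} (P : ProjectiveResolution X) (i : ℕ) :
    Module.Projective R (P.complex.X i) :=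
  (P.complex.X i).projective_of_module_projective

/-- `Tor` is computed by tensoring with a projective resolution of the second variable. -/
noncomputable def torMIso (M : ModuleCat.{u} R) {N : ModuleCat.{u} R}
    (P : ProjectiveResolution N) (i : ℕ) :
    torM R i M N ≅ ((((tensoringLeft (ModuleCat.{u} R)).obj M).mapHomologicalComplex
      (ComplexShape.down ℕ)).obj P.complex).homology i :=
  P.isoLeftDerivedObj _ i

theorem subsingleton_torM_succ_iff (M : ModuleCat.{u} R) {N : ModuleCat.{u} R}
    (P : ProjectiveResolution N) (i : ℕ) :
    Subsingleton (torM R (i + 1) M N) ↔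
      Function.Exact ((P.complex.d (i + 2) (i + 1)).hom.lTensor M)
        ((P.complex.d (i + 1) i).hom.lTensor M) := by
  rw [← ModuleCat.isZero_iff_subsingleton, (torMIso M P (i + 1)).isZero_iff,
    ← HomologicalComplex.exactAt_iff_isZero_homology,
    HomologicalComplex.exactAt_iff' _ (i + 2) (i + 1) i (by simp) (by simp),
    ShortComplex.ShortExact.moduleCat_exact_iff_function_exact]
  rfl

theorem subsingleton_torM_succ_of_flat (M N : ModuleCat.{u} R) [Module.Flat R M] (i : ℕ) :
    Subsingleton (torM R (i + 1) M N) := by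
  rw [subsingleton_torM_succ_iff M (projectiveResolution N)]
  exact Module.Flat.lTensor_exact M (ProjectiveResolution.exact_succ_linearMap _ i)

section

variable {M Y N : ModuleCat.{u} R} {x : R} {q : M →ₗ[R] Y}

theorem exact_smul_rTensor (hq : Function.Surjective q)
    (hxq : Function.Exact (fun m : M ↦ x • m) q) (P : Type u) [AddCommGroup P] [Module R P] :
    Function.Exact (fun c : M ⊗[R] P ↦ x • c) (q.rTensor P) := by
  have h := rTensor_exact P (f := LinearMap.lsmul R M x) (g := q) hxq hq
  convert! h using 1

/-- If `x` is regular on `M` and `Y ≅ M/xM`, then `Tor_{i+2}(Y, N)` vanishes as soon as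
`Tor_{i+1}(M, N)` and `Tor_{i+2}(M, N)` do. -/
theorem subsingleton_torM_of_regular (hq : Function.Surjective q)
    (hxq : Function.Exact (fun m : M ↦ x • m) q) (hx : IsSMulRegular M x)
    {i : ℕ} (h₁ : Subsingleton (torM R (i + 1) M N)) (h₂ : Subsingleton (torM R (i + 2) M N)) :
    Subsingleton (torM R (i + 2) Y N) := by
  let P := projectiveResolution N
  rw [subsingleton_torM_succ_iff _ P] at h₁ h₂ ⊢
  exact .of_regular_quotient (q₂ := q.rTensor _) (q₁ := q.rTensor _) (q₀ := q.rTensor _)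
    h₂ h₁ (hx.rTensor _)
    (by rw [LinearMap.lTensor_comp_rTensor, LinearMap.rTensor_comp_lTensor])
    (by rw [LinearMap.lTensor_comp_rTensor, LinearMap.rTensor_comp_lTensor])
    (LinearMap.rTensor_surjective _ hq) (LinearMap.rTensor_surjective _ hq)
    (exact_smul_rTensor hq hxq _).apply_apply_eq_zero (exact_smul_rTensor hq hxq _)

/-- If `x` is regular on `M ⊗[R] N` and `Y ≅ M/xM`, then `Tor_1(Y, N)` vanishes as soon as
`Tor_1(M, N)` does. -/
theorem subsingleton_torM_one_of_regular (hq : Function.Surjective q)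
    (hxq : Function.Exact (fun m : M ↦ x • m) q) (hx : IsSMulRegular (M ⊗[R] N) x)
    (h : Subsingleton (torM R 1 M N)) :
    Subsingleton (torM R 1 Y N) := by
  let P := projectiveResolution N
  rw [subsingleton_torM_succ_iff _ P] at h ⊢
  exact .of_regular_quotient (q₂ := q.rTensor _) (q₁ := q.rTensor _) (q₀ := q.rTensor _)
    h (lTensor_exact M P.exact_zero_linearMap P.surjective_π) hx
    (by rw [LinearMap.lTensor_comp_rTensor, LinearMap.rTensor_comp_lTensor])
    (by rw [LinearMap.lTensor_comp_rTensor, LinearMap.rTensor_comp_lTensor])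
    (LinearMap.rTensor_surjective _ hq) (LinearMap.rTensor_surjective _ hq)
    (exact_smul_rTensor hq hxq _).apply_apply_eq_zero (exact_smul_rTensor hq hxq _)

end

section

variable (R) (S : Type u) [CommRing S] [Algebra R S]

/-- The functor `X ↦ S ⊗[R] X` from `R`-modules to `S`-modules. -/
noncomputable def baseChangeFunctor : ModuleCat.{u} R ⥤ ModuleCat.{u} S where
  obj X := ModuleCat.of S (S ⊗[R] X)
  map f := ModuleCat.ofHom (f.hom.baseChange S)
  map_id X := by ext : 1; simp
  map_comp f g := by ext : 1; simp [LinearMap.baseChange_comp]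

instance : (baseChangeFunctor R S).Additive where
  map_add {X Y f g} := by
    ext : 1
    exact LinearMap.baseChange_add f.hom g.hom

variable {R}

/-- The base change to `S` of a projective resolution of `N` is again a projective resolution
if the modules `Tor_i^R(S, N)` vanish for `i ≥ 1`. -/
noncomputable def baseChangeResolution {N : ModuleCat.{u} R} (P : ProjectiveResolution N)
    (h : ∀ i, Subsingleton (torM R (i + 1) (ModuleCat.of R S) N)) :
    ProjectiveResolution ((baseChangeFunctor R S).obj N) where
  complex := ((baseChangeFunctor R S).mapHomologicalComplex _).obj P.complex
  projective n :=
    have : Module.Projective S (S ⊗[R] P.complex.X n) := inferInstance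
    (IsProjective.iff_projective (R := S) (S ⊗[R] P.complex.X n)).1 this
  π := (ChainComplex.toSingle₀Equiv _ _).symm ⟨(baseChangeFunctor R S).map (P.π.f 0),
    ((baseChangeFunctor R S).map_comp _ _).symm.trans <|
      (congrArg (baseChangeFunctor R S).map P.complex_d_comp_π_f_zero).trans
        (Functor.map_zero _ _ _)⟩
  quasiIso := ⟨fun n ↦ by
    cases n with
    | zero =>
      rw [ChainComplex.quasiIsoAt₀_iff, ShortComplex.quasiIso_iff_of_zeros']
      · refine ⟨(ShortComplex.ShortExact.moduleCat_exact_iff_function_exact _).2 ?_,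
          (ModuleCat.epi_iff_surjective _).2 ?_⟩
        · exact lTensor_exact S P.exact_zero_linearMap P.surjective_π
        · exact LinearMap.lTensor_surjective S P.surjective_π
      · exact (((baseChangeFunctor R S).mapHomologicalComplex (ComplexShape.down ℕ)).obj
          P.complex).shape 0 0 (by simp)
      all_goals rfl
    | succ i =>
      rw [quasiIsoAt_iff_exactAt' _ _ (ChainComplex.exactAt_succ_single_obj _ _),
        HomologicalComplex.exactAt_iff' _ (i + 2) (i + 1) i (by simp) (by simp),
        ShortComplex.ShortExact.moduleCat_exact_iff_function_exact]
      exact (subsingleton_torM_succ_iff _ P i).1 (h i)⟩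

variable (A : Type u) [AddCommGroup A] [Module R A] [Module S A] [IsScalarTower R S A]

/-- `A ⊗[S] (S ⊗[R] X)` and `A ⊗[R] X` are isomorphic as `R`-modules. -/
noncomputable def baseChangeTensorEquiv (X : ModuleCat.{u} R) :
    ((ModuleCat.restrictScalars (algebraMap R S)).obj
      (ModuleCat.of S A ⊗ (baseChangeFunctor R S).obj X) : ModuleCat.{u} R) ≃ₗ[R]
      (ModuleCat.of R A ⊗ X : ModuleCat.{u} R) where
  __ := (AlgebraTensorModule.cancelBaseChange R S S A X).toAddEquiv
  map_smul' r y :=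
    ((AlgebraTensorModule.cancelBaseChange R S S A X).map_smul (algebraMap R S r) y).trans
      (algebraMap_smul S r _)

/-- Tensoring with an `S`-module over `R` factors through base change to `S`. -/
noncomputable def baseChangeTensorIso :
    baseChangeFunctor R S ⋙ (tensoringLeft (ModuleCat.{u} S)).obj (ModuleCat.of S A) ⋙
      ModuleCat.restrictScalars (algebraMap R S) ≅
    (tensoringLeft (ModuleCat.{u} R)).obj (ModuleCat.of R A) :=
  NatIso.ofComponents (fun X ↦ (baseChangeTensorEquiv S A X).toModuleIso) fun {X Y} f ↦ by
    ext (y : A ⊗[S] (S ⊗[R] X))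
    change AlgebraTensorModule.cancelBaseChange R S S A Y
        ((f.hom.baseChange S).lTensor A y) =
      f.hom.lTensor A (AlgebraTensorModule.cancelBaseChange R S S A X y)
    induction y with
    | zero => simp
    | add y z hy hz => simp only [map_add, hy, hz]
    | tmul a y =>
      induction y with
      | zero => simp
      | add y z hy hz => simp only [tmul_add, map_add, hy, hz]
      | tmul s z => simp

/-- If `Tor_i^R(S, N)` vanishes for `i ≥ 1`, then `Tor_i^S(A, S ⊗[R] N)` is isomorphic to
`Tor_i^R(A, N)` for every `S`-module `A`. -/
noncomputable def torMBaseChangeIso (N : ModuleCat.{u} R)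
    (h : ∀ i, Subsingleton (torM R (i + 1) (ModuleCat.of R S) N)) (i : ℕ) :
    (ModuleCat.restrictScalars (algebraMap R S)).obj
      (torM S i (ModuleCat.of S A) ((baseChangeFunctor R S).obj N)) ≅
    torM R i (ModuleCat.of R A) N :=
  let P := projectiveResolution N
  (ModuleCat.restrictScalars (algebraMap R S)).mapIso
      (torMIso (ModuleCat.of S A) (baseChangeResolution S P h) i) ≪≫
    (ShortComplex.mapHomologyIso (HomologicalComplex.sc _ i)
      (ModuleCat.restrictScalars (algebraMap R S))).symm ≪≫
    (HomologicalComplex.homologyFunctor _ _ i).mapIso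
      ((NatIso.mapHomologicalComplex (baseChangeTensorIso S A) _).app P.complex) ≪≫
    (torMIso (ModuleCat.of R A) P i).symm

end

theorem Function.exact_smul_mkQ (M : Type*) [AddCommGroup M] [Module R M] (x : R) :
    Function.Exact (fun m : M ↦ x • m) (Ideal.span {x} • ⊤ : Submodule R M).mkQ := fun m ↦ by
  rw [Submodule.mkQ_apply, Submodule.Quotient.mk_eq_zero, Submodule.ideal_span_singleton_smul,
    Submodule.mem_smul_pointwise_iff_exists]
  simp

theorem Function.exact_smul_ideal_quotient_mk (x : R) :
    Function.Exact (fun r : R ↦ x • r) (Algebra.linearMap R (R ⧸ Ideal.span {x})) := fun r ↦ by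
  rw [Algebra.linearMap_apply, Ideal.Quotient.algebraMap_eq, Ideal.Quotient.eq_zero_iff_mem,
    Ideal.mem_span_singleton]
  simp [dvd_def, eq_comm]

theorem subsingleton_torM_quotient_span {x : R} {N : ModuleCat.{u} R} (hxR : IsSMulRegular R x)
    (hxN : IsSMulRegular N x) (i : ℕ) :
    Subsingleton (torM R (i + 1) (ModuleCat.of R (R ⧸ Ideal.span {x})) N) := by
  have hq : Function.Surjective (Algebra.linearMap R (R ⧸ Ideal.span {x})) :=
    Ideal.Quotient.mk_surjective
  have h i : Subsingleton (torM R (i + 1) (ModuleCat.of R R) N) :=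
    subsingleton_torM_succ_of_flat _ _ i
  cases i with
  | zero =>
    exact subsingleton_torM_one_of_regular (M := ModuleCat.of R R) hq
      (Function.exact_smul_ideal_quotient_mk x)
      (((TensorProduct.lid R N).isSMulRegular_congr x).2 hxN) (h 0)
  | succ i =>
    exact subsingleton_torM_of_regular (M := ModuleCat.of R R) hq
      (Function.exact_smul_ideal_quotient_mk x) hxR (h i) (h (i + 1))

/-- `(R ⧸ I) ⊗[R] N` is isomorphic to `N ⧸ I N` as a module over `R ⧸ I`. -/
noncomputable def baseChangeQuotientIso (I : Ideal R) (N : Type u) [AddCommGroup N] [Module R N] :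
    (baseChangeFunctor R (R ⧸ I)).obj (ModuleCat.of R N) ≅
      ModuleCat.of (R ⧸ I) (N ⧸ (I • ⊤ : Submodule R N)) :=
  LinearEquiv.toModuleIso
    ((TensorProduct.quotTensorEquivQuotSMul N I).extendScalarsOfSurjective
      Ideal.Quotient.mk_surjective)

/-- If `x` is regular on `R` and on `N`, then `Tor_i^{R/xR}(A, N/xN)` is isomorphic to
`Tor_i^R(A, N)` for every `R/xR`-module `A`. -/
noncomputable def torModQuotientIso {x : R} (A N : Type u) [AddCommGroup A] [Module R A]
    [Module (R ⧸ Ideal.span {x}) A] [IsScalarTower R (R ⧸ Ideal.span {x}) A]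
    [AddCommGroup N] [Module R N] (hxR : IsSMulRegular R x) (hxN : IsSMulRegular N x) (i : ℕ) :
    (ModuleCat.restrictScalars (Ideal.Quotient.mk (Ideal.span {x}))).obj
      (torMod (R ⧸ Ideal.span {x}) i A (N ⧸ (Ideal.span {x} • ⊤ : Submodule R N))) ≅
    torMod R i A N :=
  (ModuleCat.restrictScalars (Ideal.Quotient.mk (Ideal.span {x}))).mapIso
      (((Tor _ i).obj _).mapIso (baseChangeQuotientIso (Ideal.span {x}) N).symm) ≪≫
    torMBaseChangeIso (R ⧸ Ideal.span {x}) A (ModuleCat.of R N)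
      (subsingleton_torM_quotient_span hxR hxN) i

end

/-- for Tor-independent `M`, `N` and `x ∈ m` regular on `R`, `M`, `N`:
`Tor_p^{R/xR}(M/xM, N/xN) = 0` for `p ≥ 2` and
`Tor_1^{R/xR}(M/xM, N/xN) ≅ Tor_1^R(M/xM, N)`. -/
theorem stmt_2 (R : Type u) [CommRing R] [IsNoetherianRing R] [IsLocalRing R]
    (hR : 0 < eDepth R R)
    (M N : Type u) [AddCommGroup M] [Module R M] [AddCommGroup N] [Module R N]
    [Module.Finite R M] [Module.Finite R N] [Nontrivial M] [Nontrivial N]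
    (hTI : TorIndep R M N)
    (x : R) (hx : x ∈ IsLocalRing.maximalIdeal R)
    (hxR : IsSMulRegular R x) (hxM : IsSMulRegular M x) (hxN : IsSMulRegular N x) :
    (∀ p : ℕ, 2 ≤ p →
      Subsingleton (torMod (R ⧸ Ideal.span {x}) p
        (M ⧸ (Ideal.span {x} • ⊤ : Submodule R M))
        (N ⧸ (Ideal.span {x} • ⊤ : Submodule R N)))) ∧
    Nonempty
      ((ModuleCat.restrictScalars (Ideal.Quotient.mk (Ideal.span {x}))).obj
          (torMod (R ⧸ Ideal.span {x}) 1
            (M ⧸ (Ideal.span {x} • ⊤ : Submodule R M))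
            (N ⧸ (Ideal.span {x} • ⊤ : Submodule R N)))
        ≅ torMod R 1 (M ⧸ (Ideal.span {x} • ⊤ : Submodule R M)) N) := by
  refine ⟨fun p hp ↦ ?_, ⟨torModQuotientIso _ N hxR hxN 1⟩⟩
  obtain ⟨i, rfl⟩ := Nat.exists_eq_add_of_le' hp
  have : Subsingleton (torMod R (i + 2) (M ⧸ (Ideal.span {x} • ⊤ : Submodule R M)) N) :=
    subsingleton_torM_of_regular (M := ModuleCat.of R M) (Submodule.mkQ_surjective _)
      (Function.exact_smul_mkQ M x) hxM (hTI (i + 1) (by lia)) (hTI (i + 2) (by lia))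
  exact (torModQuotientIso _ N hxR hxN (i + 2)).toLinearEquiv.toEquiv.subsingleton
end

section
/- Let (R, m) be a commutative Noetherian local ring, and let M and N be finitely generated Tor-independent R-modules (Tor_i^R(M,N) = 0 for all i ≥ 1). If x ∈ m is regular on R, M, N, and M ⊗_R N, then M/xM and N/xN are Tor-independent modules over R/xR, i.e., Tor_i^{R/xR}(M/xM, N/xN) = 0 for all i ≥ 1. -/
open CategoryTheory

universe u

open Function LinearMap TensorProduct

lemma torIndep_iff_exact_lTensor {R : Type u} [CommRing R] {M N : Type u} [AddCommGroup M]
    [Module R M] [AddCommGroup N] [Module R N] (P : ProjectiveResolution (ModuleCat.of R N)) :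
    TorIndep R M N ↔ ∀ n : ℕ, Exact ((P.complex.d (n + 2) (n + 1)).hom.lTensor M)
      ((P.complex.d (n + 1) n).hom.lTensor M) := by
  have key (n : ℕ) : Subsingleton (torMod R (n + 1) M N) ↔
      Exact ((P.complex.d (n + 2) (n + 1)).hom.lTensor M)
      ((P.complex.d (n + 1) n).hom.lTensor M) := by
    rw [← ModuleCat.isZero_iff_subsingleton]
    refine (P.isoLeftDerivedObj ((MonoidalCategory.tensoringLeft (ModuleCat R)).obj (.of R M))
      (n + 1)).isZero_iff.trans ?_
    refine (HomologicalComplex.exactAt_iff_isZero_homology _ _).symm.trans ?_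
    rw [HomologicalComplex.exactAt_iff' _ (n + 2) (n + 1) n (by simp) (by simp),
      ShortComplex.ShortExact.moduleCat_exact_iff_function_exact]
    rfl
  refine ⟨fun h n ↦ (key n).1 (h (n + 1) (by omega)), fun h i hi ↦ ?_⟩
  obtain ⟨n, rfl⟩ := Nat.exists_eq_add_of_le' hi
  exact (key n).2 (h n)

namespace CategoryTheory.ProjectiveResolution

section

variable {R : Type u} [CommRing R] {N : Type u} [AddCommGroup N] [Module R N]
  (P : ProjectiveResolution (ModuleCat.of R N))

lemma moduleCat_exact_succ (n : ℕ) :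
    Exact (P.complex.d (n + 2) (n + 1)).hom (P.complex.d (n + 1) n).hom :=
  (ShortComplex.ShortExact.moduleCat_exact_iff_function_exact _).1 (P.exact_succ n)

lemma moduleCat_exact_zero : Exact (P.complex.d 1 0).hom (P.π.f 0).hom :=
  (ShortComplex.ShortExact.moduleCat_exact_iff_function_exact _).1 P.exact₀

lemma moduleCat_surjective : Function.Surjective (P.π.f 0).hom :=
  (ModuleCat.epi_iff_surjective _).1 inferInstance

end

/-- An exact augmented complex of projective modules is a projective resolution. -/
noncomputable def ofModuleCatExact {R : Type u} [CommRing R] {Z : ModuleCat.{u} R}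
    (C : ChainComplex (ModuleCat.{u} R) ℕ) [∀ n, Projective (C.X n)] (ε : C.X 0 ⟶ Z)
    (hε : Function.Surjective ε.hom) (h₀ : Exact (C.d 1 0).hom ε.hom)
    (h : ∀ n, Exact (C.d (n + 2) (n + 1)).hom (C.d (n + 1) n).hom) :
    ProjectiveResolution Z where
  complex := C
  π := (ChainComplex.toSingle₀Equiv _ _).symm
    ⟨ε, ModuleCat.hom_ext (LinearMap.ext h₀.apply_apply_eq_zero)⟩
  quasiIso := ⟨fun n ↦ by
    cases n with
    | zero =>
      rw [ChainComplex.quasiIsoAt₀_iff,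
        ShortComplex.quasiIso_iff_of_zeros' _ (C.shape _ _ (by simp)) rfl rfl]
      have w : C.d 1 0 ≫ ε = 0 := ModuleCat.hom_ext (LinearMap.ext h₀.apply_apply_eq_zero)
      refine (ShortComplex.exact_and_epi_g_iff_of_iso
        (S₂ := ShortComplex.mk (C.d 1 0) ε w) ?_).2
        ⟨(ShortComplex.ShortExact.moduleCat_exact_iff_function_exact _).2 h₀,
          (ModuleCat.epi_iff_surjective _).2 hε⟩
      exact ShortComplex.isoMk (Iso.refl _) (Iso.refl _) (Iso.refl _)
        ((Category.id_comp _).trans (Category.comp_id _).symm)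
        (by
          refine Eq.trans ?_ (congrArg (· ≫ 𝟙 Z)
            (ChainComplex.toSingle₀Equiv_symm_apply_f_zero ε w)).symm
          exact (Category.id_comp _).trans (Category.comp_id _).symm)
    | succ n =>
      rw [quasiIsoAt_iff_exactAt' _ _ (ChainComplex.exactAt_succ_single_obj _ _),
        HomologicalComplex.exactAt_iff' _ (n + 2) (n + 1) n (by simp) (by simp)]
      exact (ShortComplex.ShortExact.moduleCat_exact_iff_function_exact _).2 (h n)⟩

end CategoryTheory.ProjectiveResolution

/-- Degreewise extension of scalars of a complex of modules. -/
noncomputable def ChainComplex.moduleBaseChange {R : Type u} [CommRing R]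
    (C : ChainComplex (ModuleCat.{u} R) ℕ) (S : Type u) [CommRing S] [Algebra R S] :
    ChainComplex (ModuleCat.{u} S) ℕ where
  X n := ModuleCat.of S (S ⊗[R] C.X n)
  d i j := ModuleCat.ofHom ((C.d i j).hom.baseChange S)
  shape i j hij := by simp [C.shape i j hij]
  d_comp_d' i j k _ _ := by
    rw [← ModuleCat.ofHom_comp, ← baseChange_comp, ← ModuleCat.hom_comp, C.d_comp_d]
    simp

instance {R : Type u} [CommRing R] (C : ChainComplex (ModuleCat.{u} R) ℕ)
    [∀ n, Projective (C.X n)] (S : Type u) [CommRing S] [Algebra R S] (n : ℕ) :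
    Projective ((ChainComplex.moduleBaseChange C S).X n) := by
  have : Module.Projective R (C.X n) := (IsProjective.iff_projective _).2 inferInstance
  exact (IsProjective.iff_projective (R := S) (P := S ⊗[R] C.X n)).1 inferInstance

section

variable {R : Type*} [CommRing R]

lemma exact_lTensor_quotient_iff {A B C : Type*} [AddCommGroup A] [Module R A] [AddCommGroup B]
    [Module R B] [AddCommGroup C] [Module R C] (x : R) (f : A →ₗ[R] B) (g : B →ₗ[R] C) :
    Exact (f.lTensor (R ⧸ Ideal.span {x})) (g.lTensor (R ⧸ Ideal.span {x})) ↔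
      Exact (QuotSMulTop.map x f) (QuotSMulTop.map x g) :=
  Exact.iff_of_ladder_linearEquiv (QuotSMulTop.equivQuotTensor_naturality x f).symm
    (QuotSMulTop.equivQuotTensor_naturality x g).symm

lemma exact_lTensor_baseChange_iff {S : Type*} [CommRing S] [Algebra R S]
    {M A B C : Type*} [AddCommGroup M] [Module R M] [Module S M] [IsScalarTower R S M]
    [AddCommGroup A] [Module R A] [AddCommGroup B]
    [Module R B] [AddCommGroup C] [Module R C] (f : A →ₗ[R] B) (g : B →ₗ[R] C) :
    Exact ((f.baseChange S).lTensor M) ((g.baseChange S).lTensor M) ↔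
      Exact (f.lTensor M) (g.lTensor M) := by
  refine (Exact.iff_of_ladder_linearEquiv
    (e₁ := AlgebraTensorModule.cancelBaseChange R S S M A)
    (e₂ := AlgebraTensorModule.cancelBaseChange R S S M B)
    (e₃ := AlgebraTensorModule.cancelBaseChange R S S M C)
    (g₁₂ := AlgebraTensorModule.lTensor S M f) (g₂₃ := AlgebraTensorModule.lTensor S M g)
    ?_ ?_).symm <;>
  · ext; simp

/-- `(M / xM) ⊗ A ≃ (R / x) ⊗ (M ⊗ A)`. -/
noncomputable def quotIdealSMulTensorEquiv (x : R) (M A : Type*) [AddCommGroup M] [Module R M]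
    [AddCommGroup A] [Module R A] :
    (M ⧸ (Ideal.span {x} • ⊤ : Submodule R M)) ⊗[R] A ≃ₗ[R]
      (R ⧸ Ideal.span {x}) ⊗[R] (M ⊗[R] A) :=
  (quotTensorEquivQuotSMul M (Ideal.span {x})).symm.rTensor A ≪≫ₗ TensorProduct.assoc R _ M A

lemma exact_quotient_lTensor_iff {M A B C : Type*} [AddCommGroup M] [Module R M]
    [AddCommGroup A] [Module R A] [AddCommGroup B]
    [Module R B] [AddCommGroup C] [Module R C] (x : R) (f : A →ₗ[R] B) (g : B →ₗ[R] C) :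
    Exact (f.lTensor (M ⧸ (Ideal.span {x} • ⊤ : Submodule R M)))
      (g.lTensor (M ⧸ (Ideal.span {x} • ⊤ : Submodule R M))) ↔
    Exact ((f.lTensor M).lTensor (R ⧸ Ideal.span {x}))
      ((g.lTensor M).lTensor (R ⧸ Ideal.span {x})) := by
  refine (Exact.iff_of_ladder_linearEquiv (e₁ := quotIdealSMulTensorEquiv x M A)
    (e₂ := quotIdealSMulTensorEquiv x M B) (e₃ := quotIdealSMulTensorEquiv x M C) ?_ ?_).symm <;>
  · refine TensorProduct.ext' fun m a ↦ ?_
    obtain ⟨m, rfl⟩ := Submodule.Quotient.mk_surjective _ m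
    simp [quotIdealSMulTensorEquiv]

end

lemma isSMulRegular_of_projective {R : Type*} [CommRing R] {x : R} (hx : IsSMulRegular R x)
    (A : Type*) [AddCommGroup A] [Module R A] [Module.Projective R A] : IsSMulRegular A x :=
  (IsSMulRegular.lTensor A hx).of_injective (TensorProduct.rid R A).symm.toLinearMap
    (TensorProduct.rid R A).symm.injective

/-- Reduction of a projective resolution modulo an element regular on the ring and the module. -/
noncomputable def CategoryTheory.ProjectiveResolution.quotient {R : Type u} [CommRing R]
    {N : Type u} [AddCommGroup N] [Module R N] (P : ProjectiveResolution (ModuleCat.of R N))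
    {x : R} (hxR : IsSMulRegular R x) (hxN : IsSMulRegular N x) :
    ProjectiveResolution
      (ModuleCat.of (R ⧸ Ideal.span {x}) (N ⧸ (Ideal.span {x} • ⊤ : Submodule R N))) :=
  have hproj (n : ℕ) : Module.Projective R (P.complex.X n) :=
    (IsProjective.iff_projective _).2 (P.projective n)
  let e := (quotTensorEquivQuotSMul N (Ideal.span {x})).extendScalarsOfSurjective
    (S := R ⧸ Ideal.span {x}) Ideal.Quotient.mk_surjective
  ofModuleCatExact (ChainComplex.moduleBaseChange P.complex (R ⧸ Ideal.span {x}))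
    (ModuleCat.ofHom (e.toLinearMap ∘ₗ (P.π.f 0).hom.baseChange (R ⧸ Ideal.span {x})))
    (e.surjective.comp (lTensor_surjective _ P.moduleCat_surjective))
    ((lTensor_exact _ P.moduleCat_exact_zero P.moduleCat_surjective).comp_injective _
      e.injective e.map_zero)
    (fun n ↦ by
      refine (exact_lTensor_quotient_iff x _ _).2 ?_
      cases n with
      | zero =>
        exact QuotSMulTop.map_first_exact_on_four_term_exact_of_isSMulRegular_last
          (P.moduleCat_exact_succ 0) P.moduleCat_exact_zero hxN
      | succ n =>
        exact QuotSMulTop.map_first_exact_on_four_term_exact_of_isSMulRegular_last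
          (P.moduleCat_exact_succ (n + 1)) (P.moduleCat_exact_succ n)
          (isSMulRegular_of_projective hxR _))

/-- if `M`, `N` are Tor-independent over `R` and `x ∈ m` is regular on
`R`, `M`, `N` and `M ⊗_R N`, then `M/xM` and `N/xN` are Tor-independent over `R/xR`. -/
theorem stmt_3 (R : Type u) [CommRing R] [IsNoetherianRing R] [IsLocalRing R]
    (M N : Type u) [AddCommGroup M] [Module R M] [AddCommGroup N] [Module R N]
    [Module.Finite R M] [Module.Finite R N]
    (hTI : TorIndep R M N)
    (x : R) (hx : x ∈ IsLocalRing.maximalIdeal R)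
    (hxR : IsSMulRegular R x) (hxM : IsSMulRegular M x) (hxN : IsSMulRegular N x)
    (hxMN : IsSMulRegular (TensorProduct R M N) x) :
    TorIndep (R ⧸ Ideal.span {x})
      (M ⧸ (Ideal.span {x} • ⊤ : Submodule R M))
      (N ⧸ (Ideal.span {x} • ⊤ : Submodule R N)) := by
  have P := projectiveResolution (ModuleCat.of R N)
  have hexact := (torIndep_iff_exact_lTensor P).1 hTI
  refine (torIndep_iff_exact_lTensor (P.quotient hxR hxN)).2 fun n ↦ ?_
  refine (exact_lTensor_baseChange_iff (R := R) (P.complex.d (n + 2) (n + 1)).hom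
    (P.complex.d (n + 1) n).hom).2 ?_
  refine (exact_quotient_lTensor_iff x _ _).2 ((exact_lTensor_quotient_iff x _ _).2 ?_)
  cases n with
  | zero =>
    exact QuotSMulTop.map_first_exact_on_four_term_exact_of_isSMulRegular_last (hexact 0)
      (lTensor_exact M P.moduleCat_exact_zero P.moduleCat_surjective) hxMN
  | succ n =>
    have : Module.Projective R (P.complex.X n) :=
      (IsProjective.iff_projective _).2 (P.projective n)
    exact QuotSMulTop.map_first_exact_on_four_term_exact_of_isSMulRegular_last
      (hexact (n + 1)) (hexact n) (hxM.rTensor _)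
end

section
/- Let (R, m) be a commutative Noetherian local ring and let M and N be finitely generated R-modules with Tor_1^R(M, N) = 0. Then either depth M ≤ depth(M ⊗_R N), or depth(M ⊗_R Ω) = depth(M ⊗_R N) + 1, where Ω is a first syzygy of N (the kernel of a surjection from a finite free module Q_0 onto N). -/
open CategoryTheory

universe u

/-- The cochain map `Hom(X, Y) ⟶ Hom(X, Z)` induced by a morphism `Y ⟶ Z`. -/
noncomputable def linearYonedaObjMap (R : Type u) [CommRing R]
    (X : ChainComplex (ModuleCat.{u} R) ℕ) {Y Z : ModuleCat.{u} R} (f : Y ⟶ Z) :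
    X.linearYonedaObj R Y ⟶ X.linearYonedaObj R Z where
  f i := ModuleCat.ofHom (Linear.rightComp R (X.X i) f)
  comm' i j _ := by
    ext x
    exact (Category.assoc (X.d j i) (show X.X i ⟶ Y from x) f).symm

/-- The short complex of cochain complexes `Hom(X, S.X₁) ⟶ Hom(X, S.X₂) ⟶ Hom(X, S.X₃)`. -/
noncomputable def linearYonedaShortComplex (R : Type u) [CommRing R]
    (X : ChainComplex (ModuleCat.{u} R) ℕ) (S : ShortComplex (ModuleCat.{u} R)) :
    ShortComplex (CochainComplex (ModuleCat.{u} R) ℕ) where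
  X₁ := X.linearYonedaObj R S.X₁
  X₂ := X.linearYonedaObj R S.X₂
  X₃ := X.linearYonedaObj R S.X₃
  f := linearYonedaObjMap R X S.f
  g := linearYonedaObjMap R X S.g
  zero := by
    ext i x
    let y : X.X i ⟶ S.X₁ := x
    change (y ≫ S.f) ≫ S.g = 0
    simp

lemma linearYonedaShortComplex_shortExact {R : Type u} [CommRing R]
    (X : ChainComplex (ModuleCat.{u} R) ℕ) [∀ i, Projective (X.X i)]
    {S : ShortComplex (ModuleCat.{u} R)} (hS : S.ShortExact) :
    (linearYonedaShortComplex R X S).ShortExact := by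
  have := hS.mono_f
  have := hS.epi_g
  refine HomologicalComplex.shortExact_of_degreewise_shortExact _ fun i ↦ ?_
  refine { exact := ?_, mono_f := ?_, epi_g := ?_ }
  · rw [ShortComplex.moduleCat_exact_iff]
    intro x hx
    exact ⟨hS.exact.lift x hx, hS.exact.lift_f x hx⟩
  · rw [ModuleCat.mono_iff_injective]
    intro x y hxy
    exact (cancel_mono S.f).1 hxy
  · rw [ModuleCat.epi_iff_surjective]
    intro x
    exact ⟨Projective.factorThru x S.g, Projective.factorThru_comp x S.g⟩

lemma isZero_homology_zero_of_shortExact {C : Type*} [Category* C] [Abelian C]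
    {S : ShortComplex (CochainComplex C ℕ)} (hS : S.ShortExact)
    (h : Limits.IsZero (S.X₂.homology 0)) : Limits.IsZero (S.X₁.homology 0) := by
  have := hS.mono_f
  rw [← S.X₂.isoHomologyπ₀.isZero_iff] at h
  rw [← S.X₁.isoHomologyπ₀.isZero_iff]
  exact h.of_mono (HomologicalComplex.cyclesMap S.f 0)

section extMod

variable {R : Type u} [CommRing R] {K A B C : Type u} [AddCommGroup K] [Module R K]
  [AddCommGroup A] [Module R A] [AddCommGroup B] [Module R B] [AddCommGroup C] [Module R C]

lemma subsingleton_extMod_iff (i : ℕ) :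
    Subsingleton (extMod R i K A) ↔
      Limits.IsZero (((projectiveResolution (ModuleCat.of R K)).complex.linearYonedaObj R
        (ModuleCat.of R A)).homology i) := by
  rw [← ModuleCat.isZero_iff_subsingleton]
  exact ((projectiveResolution (ModuleCat.of R K)).isoExt i (ModuleCat.of R A)).isZero_iff

lemma subsingleton_extMod_congr (e : A ≃ₗ[R] B) (i : ℕ) :
    Subsingleton (extMod R i K A) ↔ Subsingleton (extMod R i K B) :=
  (((Ext R (ModuleCat.{u} R) i).obj _).mapIso e.toModuleIso).toLinearEquiv.toEquiv.subsingleton_congr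

/-- Applying `Hom(P, -)`, with `P` a projective resolution of `K`, to a short exact sequence of
modules gives a short exact sequence of cochain complexes. -/
lemma shortExact_linearYoneda (K : Type u) [AddCommGroup K] [Module R K]
    {f : A →ₗ[R] B} {g : B →ₗ[R] C} (hf : Function.Injective f)
    (hfg : Function.Exact f g) (hg : Function.Surjective g) :
    (linearYonedaShortComplex R (projectiveResolution (ModuleCat.of R K)).complex
      (ShortComplex.moduleCatMk f g hfg.linearMap_comp_eq_zero)).ShortExact := by
  refine linearYonedaShortComplex_shortExact _
    { exact := ?_, mono_f := ?_, epi_g := ?_ }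
  · rw [ShortComplex.moduleCat_exact_iff]
    exact fun x hx ↦ (hfg x).1 hx
  · exact (ModuleCat.mono_iff_injective _).2 hf
  · exact (ModuleCat.epi_iff_surjective _).2 hg

lemma subsingleton_extMod_of_exact {f : A →ₗ[R] B} {g : B →ₗ[R] C} (hf : Function.Injective f)
    (hfg : Function.Exact f g) (hg : Function.Surjective g) (i : ℕ)
    (hA : Subsingleton (extMod R i K A)) (hC : Subsingleton (extMod R i K C)) :
    Subsingleton (extMod R i K B) := by
  rw [subsingleton_extMod_iff] at *
  exact ((shortExact_linearYoneda K hf hfg hg).homology_exact₂ i).isZero_of_both_zeros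
    (hA.eq_of_src _ _) (hC.eq_of_tgt _ _)

/-- Dimension shifting: `Ext^i(K, C) = 0` follows from `Ext^{i+1}(K, A) = 0` when
`Ext^i(K, B) = 0`. -/
lemma subsingleton_extMod_right {f : A →ₗ[R] B} {g : B →ₗ[R] C} (hf : Function.Injective f)
    (hfg : Function.Exact f g) (hg : Function.Surjective g) (i : ℕ)
    (hB : Subsingleton (extMod R i K B)) (hA : Subsingleton (extMod R (i + 1) K A)) :
    Subsingleton (extMod R i K C) := by
  rw [subsingleton_extMod_iff] at *
  exact ((shortExact_linearYoneda K hf hfg hg).homology_exact₃ i (i + 1) rfl).isZero_of_both_zeros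
    (hB.eq_of_src _ _) (hA.eq_of_tgt _ _)

/-- Dimension shifting: `Ext^{i+1}(K, A) = 0` follows from `Ext^i(K, C) = 0` when
`Ext^{i+1}(K, B) = 0`. -/
lemma subsingleton_extMod_left {f : A →ₗ[R] B} {g : B →ₗ[R] C} (hf : Function.Injective f)
    (hfg : Function.Exact f g) (hg : Function.Surjective g) (i : ℕ)
    (hC : Subsingleton (extMod R i K C)) (hB : Subsingleton (extMod R (i + 1) K B)) :
    Subsingleton (extMod R (i + 1) K A) := by
  rw [subsingleton_extMod_iff] at *
  exact ((shortExact_linearYoneda K hf hfg hg).homology_exact₁ i (i + 1) rfl).isZero_of_both_zeros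
    (hC.eq_of_src _ _) (hB.eq_of_tgt _ _)

lemma subsingleton_extMod_zero_left {f : A →ₗ[R] B} {g : B →ₗ[R] C} (hf : Function.Injective f)
    (hfg : Function.Exact f g) (hg : Function.Surjective g)
    (hB : Subsingleton (extMod R 0 K B)) : Subsingleton (extMod R 0 K A) := by
  rw [subsingleton_extMod_iff] at *
  exact isZero_homology_zero_of_shortExact (shortExact_linearYoneda K hf hfg hg) hB

lemma subsingleton_extMod_of_subsingleton [Subsingleton A] (i : ℕ) :
    Subsingleton (extMod R i K A) := by
  rw [subsingleton_extMod_iff, ← HomologicalComplex.exactAt_iff_isZero_homology,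
    HomologicalComplex.exactAt_iff]
  refine ShortComplex.exact_of_isZero_X₂ _ (ModuleCat.isZero_iff_subsingleton.2 ⟨fun x y ↦ ?_⟩)
  exact (ModuleCat.isZero_iff_subsingleton.2 ‹Subsingleton A›).eq_of_tgt x y

lemma subsingleton_extMod_pi (n i : ℕ) (h : Subsingleton (extMod R i K A)) :
    Subsingleton (extMod R i K (Fin n → A)) := by
  induction n with
  | zero => exact subsingleton_extMod_of_subsingleton i
  | succ n ih =>
    rw [← subsingleton_extMod_congr (Fin.consLinearEquiv R fun _ : Fin (n + 1) ↦ A)]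
    exact subsingleton_extMod_of_exact (f := LinearMap.inl R A (Fin n → A))
      (g := LinearMap.snd R A (Fin n → A)) LinearMap.inl_injective
      Function.Exact.inl_snd LinearMap.snd_surjective i h ih

lemma subsingleton_extMod_tensor_free {Q : Type u} [AddCommGroup Q] [Module R Q]
    [Module.Free R Q] [Module.Finite R Q] (i : ℕ) (h : Subsingleton (extMod R i K A)) :
    Subsingleton (extMod R i K (TensorProduct R A Q)) := by
  let b := (Module.Free.chooseBasis R Q).reindex (Fintype.equivFin _)
  rw [subsingleton_extMod_congr ((LinearEquiv.lTensor A b.equivFun).trans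
    (TensorProduct.piScalarRight R R A _))]
  exact subsingleton_extMod_pi _ i h

end extMod

section torMod

variable {R : Type u} [CommRing R] {M N : Type u} [AddCommGroup M] [Module R M]
  [AddCommGroup N] [Module R N]

/-- If `Tor₁(M, N) = 0`, then tensoring the chosen projective resolution of `N` with `M` yields a
complex that is exact in degree one. -/
lemma exact_lTensor_of_subsingleton_torMod (h : Subsingleton (torMod R 1 M N)) :
    Function.Exact
      (((projectiveResolution (ModuleCat.of R N)).complex.d 2 1).hom.lTensor M)
      (((projectiveResolution (ModuleCat.of R N)).complex.d 1 0).hom.lTensor M) := by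
  rw [← ModuleCat.isZero_iff_subsingleton] at h
  set P := projectiveResolution (ModuleCat.of R N)
  have hex := (P.isoLeftDerivedObj
    ((MonoidalCategory.tensoringLeft (ModuleCat.{u} R)).obj (ModuleCat.of R M)) 1).isZero_iff.1 h
  replace hex := (HomologicalComplex.exactAt_iff_isZero_homology _ _).2 hex
  rw [HomologicalComplex.exactAt_iff' _ 2 1 0 (by simp) (by simp),
    ShortComplex.ShortExact.moduleCat_exact_iff_function_exact] at hex
  exact hex

/-- If `Tor₁(M, N) = 0`, then `M ⊗ -` preserves the injectivity of the inclusion of the kernel of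
any surjection from a projective module onto `N`. -/
lemma lTensor_ker_injective (h : Subsingleton (torMod R 1 M N))
    {Q : Type u} [AddCommGroup Q] [Module R Q] [Module.Projective R Q]
    (g : Q →ₗ[R] N) (hg : Function.Surjective g) :
    Function.Injective ((LinearMap.ker g).subtype.lTensor M) := by
  have hex := exact_lTensor_of_subsingleton_torMod h
  set P := projectiveResolution (ModuleCat.of R N)
  let p : P.complex.X 0 →ₗ[R] N := (P.π.f 0).hom
  have hp : Function.Surjective p :=
    (ModuleCat.epi_iff_surjective (P.π.f 0)).1 inferInstance
  have hd : Function.Exact (P.complex.d 1 0).hom p :=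
    (ShortComplex.ShortExact.moduleCat_exact_iff_function_exact _).1 P.exact₀
  have : Module.Projective R (P.complex.X 0) :=
    (IsProjective.iff_projective _).2 (P.projective 0)
  let d₁ : P.complex.X 1 →ₗ[R] LinearMap.ker p :=
    (P.complex.d 1 0).hom.codRestrict _ fun x ↦ hd.apply_apply_eq_zero x
  have hd₁ : Function.Surjective d₁ := by
    rintro ⟨x, hx⟩
    obtain ⟨y, hy⟩ := (hd x).1 hx
    exact ⟨y, Subtype.ext hy⟩
  have hsub : (LinearMap.ker p).subtype ∘ₗ d₁ = (P.complex.d 1 0).hom := rfl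
  have hd₂ : d₁ ∘ₗ (P.complex.d 2 1).hom = 0 := by
    ext x
    exact LinearMap.congr_fun (congr_arg ModuleCat.Hom.hom (P.complex.d_comp_d 2 1 0)) x
  have hinj : ∀ x, (LinearMap.ker p).subtype.lTensor M x = 0 → x = 0 := by
    intro x hx
    obtain ⟨y, rfl⟩ := LinearMap.lTensor_surjective M hd₁ x
    rw [← LinearMap.lTensor_comp_apply, hsub] at hx
    obtain ⟨z, rfl⟩ := (hex y).1 hx
    rw [← LinearMap.lTensor_comp_apply, hd₂, LinearMap.lTensor_zero, LinearMap.zero_apply]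
  obtain ⟨φ, hφ⟩ := Module.projective_lifting_property p g hp
  obtain ⟨ψ, hψ⟩ := Module.projective_lifting_property g p hg
  let φ' : LinearMap.ker g →ₗ[R] LinearMap.ker p := φ.restrict fun x hx ↦ by
    rw [LinearMap.mem_ker, ← LinearMap.comp_apply, hφ]; exact hx
  let ψ' : LinearMap.ker p →ₗ[R] LinearMap.ker g := ψ.restrict fun x hx ↦ by
    rw [LinearMap.mem_ker, ← LinearMap.comp_apply, hψ]; exact hx
  let s : Q →ₗ[R] LinearMap.ker g := (LinearMap.id - ψ ∘ₗ φ).codRestrict _ fun x ↦ by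
    have h₁ : g (ψ (φ x)) = p (φ x) := LinearMap.congr_fun hψ (φ x)
    have h₂ : p (φ x) = g x := LinearMap.congr_fun hφ x
    simp [h₁, h₂]
  have hs : s ∘ₗ (LinearMap.ker g).subtype + ψ' ∘ₗ φ' = LinearMap.id := by
    ext x
    simp [s, φ', ψ']
  have hφ' : (LinearMap.ker p).subtype ∘ₗ φ' = φ ∘ₗ (LinearMap.ker g).subtype := rfl
  rw [injective_iff_map_eq_zero]
  intro x hx
  have h₁ : φ'.lTensor M x = 0 := hinj _ <| by
    rw [← LinearMap.lTensor_comp_apply, hφ', LinearMap.lTensor_comp_apply, hx, map_zero]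
  have h₂ := LinearMap.congr_fun (congr_arg (LinearMap.lTensor M) hs) x
  rw [LinearMap.lTensor_add, LinearMap.lTensor_comp, LinearMap.lTensor_comp] at h₂
  simpa [hx, h₁] using h₂.symm

end torMod

section eDepth

variable {R : Type u} [CommRing R] [IsLocalRing R] {M : Type u} [AddCommGroup M] [Module R M]

lemma eDepth_le_of_nontrivial {i : ℕ}
    (h : Nontrivial (extMod R i (IsLocalRing.ResidueField R) M)) : eDepth R M ≤ i :=
  sInf_le ⟨i, rfl, h⟩

lemma subsingleton_extMod_of_lt_eDepth {i : ℕ} (h : (i : ℕ∞) < eDepth R M) :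
    Subsingleton (extMod R i (IsLocalRing.ResidueField R) M) := by
  by_contra hi
  exact (eDepth_le_of_nontrivial (not_subsingleton_iff_nontrivial.1 hi)).not_gt h

lemma eDepth_eq_natCast_iff {n : ℕ} : eDepth R M = n ↔
    ¬ Subsingleton (extMod R n (IsLocalRing.ResidueField R) M) ∧
      ∀ i < n, Subsingleton (extMod R i (IsLocalRing.ResidueField R) M) := by
  constructor
  · intro h
    refine ⟨?_, fun i hi ↦ subsingleton_extMod_of_lt_eDepth (by rw [h]; exact_mod_cast hi)⟩
    set S := {n : ℕ∞ | ∃ i : ℕ, n = (i : ℕ∞) ∧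
      Nontrivial (extMod R i (IsLocalRing.ResidueField R) M)} with hS
    have hne : S.Nonempty := by
      by_contra! he
      rw [eDepth, ← hS, he, sInf_empty] at h
      exact ENat.top_ne_natCast n h
    obtain ⟨i, hi, hi'⟩ : eDepth R M ∈ S := csInf_mem hne
    rw [h, Nat.cast_inj] at hi
    rwa [hi, not_subsingleton_iff_nontrivial]
  · rintro ⟨h₁, h₂⟩
    refine le_antisymm (eDepth_le_of_nontrivial (not_subsingleton_iff_nontrivial.1 h₁)) (le_sInf ?_)
    rintro _ ⟨i, rfl, hi⟩
    by_contra! hlt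
    exact not_subsingleton_iff_nontrivial.2 hi (h₂ i (by exact_mod_cast hlt))

end eDepth

/-- if `Tor_1^R(M,N) = 0` then either `depth M ≤ depth (M ⊗ N)` or
`depth (M ⊗ Ω) = depth (M ⊗ N) + 1`, where `Ω = ker(Q₀ → N)` is a first syzygy of `N`. -/
theorem stmt_5 (R : Type u) [CommRing R] [IsNoetherianRing R] [IsLocalRing R]
    (M N : Type u) [AddCommGroup M] [Module R M] [AddCommGroup N] [Module R N]
    [Module.Finite R M] [Module.Finite R N]
    (h1 : Subsingleton (torMod R 1 M N))
    (Q : Type u) [AddCommGroup Q] [Module R Q] [Module.Free R Q] [Module.Finite R Q]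
    (g : Q →ₗ[R] N) (hg : Function.Surjective g) :
    eDepth R M ≤ eDepth R (TensorProduct R M N) ∨
      eDepth R (TensorProduct R M (LinearMap.ker g)) =
        eDepth R (TensorProduct R M N) + 1 := by
  have hinj := lTensor_ker_injective h1 g hg
  have hex := lTensor_exact M (LinearMap.exact_subtype_ker_map g) hg
  have hsurj := LinearMap.lTensor_surjective M hg
  refine or_iff_not_imp_left.2 fun hlt ↦ ?_
  rw [not_le] at hlt
  obtain ⟨d, hd⟩ := ENat.ne_top_iff_exists.1 hlt.ne_top
  rw [← hd] at hlt ⊢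
  obtain ⟨hd₁, hd₂⟩ := eDepth_eq_natCast_iff.1 hd.symm
  have hQ : ∀ i ≤ d, Subsingleton
      (extMod R i (IsLocalRing.ResidueField R) (TensorProduct R M Q)) := fun i hi ↦
    subsingleton_extMod_tensor_free i
      (subsingleton_extMod_of_lt_eDepth ((Nat.cast_le.2 hi).trans_lt hlt))
  rw [← Nat.cast_succ]
  refine eDepth_eq_natCast_iff.2 ⟨fun h ↦
    hd₁ (subsingleton_extMod_right hinj hex hsurj d (hQ d le_rfl) h), fun i hi ↦ ?_⟩
  cases i with
  | zero => exact subsingleton_extMod_zero_left hinj hex hsurj (hQ 0 (Nat.zero_le d))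
  | succ i =>
    exact subsingleton_extMod_left hinj hex hsurj i (hd₂ i (by lia)) (hQ (i + 1) (by lia))
end

section
/- Let (R, m) be a commutative Noetherian local ring and let M, N be finitely generated Tor-independent R-modules such that M has finite projective dimension. Then depth M + depth N = depth R + depth(M ⊗_R N). (Auslander's depth formula.) -/
open CategoryTheory

universe u

/-- `K` is an `n`-th syzygy of `M` coming from a resolution by finite free modules. -/
inductive IsSyzygy (R : Type u) [CommRing R] : ℕ → ModuleCat.{u} R → ModuleCat.{u} R → Prop
  | zero (M K : ModuleCat.{u} R) (e : K ≅ M) : IsSyzygy R 0 M K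
  | succ (n : ℕ) (M M' K F : ModuleCat.{u} R) (hfree : Module.Free R F)
      (hfin : Module.Finite R F) (f : K ⟶ F) (g : F ⟶ M')
      (hf : Function.Injective f) (hfg : Function.Exact f g) (hg : Function.Surjective g)
      (hM' : IsSyzygy R n M M') : IsSyzygy R (n + 1) M K

open CategoryTheory.Limits Abelian

section Bridges

variable {R : Type u} [CommRing R]

lemma ModuleCat.isZero_homology_iff {ι : Type*} {c : ComplexShape ι}
    (K : HomologicalComplex (ModuleCat.{u} R) c) {i j k : ι}
    (hi : c.prev j = i) (hk : c.next j = k) :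
    IsZero (K.homology j) ↔ Function.Exact (K.d i j) (K.d j k) := by
  rw [← HomologicalComplex.exactAt_iff_isZero_homology, K.exactAt_iff' i j k hi hk,
    ShortComplex.ShortExact.moduleCat_exact_iff_function_exact]
  rfl

lemma ModuleCat.subsingleton_iff_of_iso {X Y : ModuleCat.{u} R} (e : X ≅ Y) :
    Subsingleton X ↔ IsZero Y := by
  rw [← ModuleCat.isZero_iff_subsingleton]
  exact e.isZero_iff

lemma subsingleton_torMod_succ_iff (M N : Type u) [AddCommGroup M] [Module R M]
    [AddCommGroup N] [Module R N] (P : ProjectiveResolution (ModuleCat.of R N)) (i : ℕ) :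
    Subsingleton (torMod R (i + 1) M N) ↔
      Function.Exact ((P.complex.d (i + 2) (i + 1)).hom.lTensor M)
        ((P.complex.d (i + 1) i).hom.lTensor M) :=
  (ModuleCat.subsingleton_iff_of_iso (P.isoLeftDerivedObj
    ((MonoidalCategory.tensoringLeft (ModuleCat.{u} R)).obj (ModuleCat.of R M)) (i + 1))).trans
    (ModuleCat.isZero_homology_iff _ (by simp) (by simp))

lemma subsingleton_extMod_iff_exact (X Y : Type u) [AddCommGroup X] [Module R X]
    [AddCommGroup Y] [Module R Y] (i : ℕ) :
    Subsingleton (extMod R i X Y) ↔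
      Subsingleton (Abelian.Ext (ModuleCat.of R X) (ModuleCat.of R Y) i) := by
  let P := projectiveResolution (ModuleCat.of R X)
  refine (ModuleCat.subsingleton_iff_of_iso (P.isoExt i (ModuleCat.of R Y))).trans ?_
  cases i with
  | zero =>
    rw [ModuleCat.isZero_homology_iff (i := 0) (k := 1) _ (by simp) (by simp),
      Ext.addEquiv₀.subsingleton_congr]
    have h0 : (P.complex.linearYonedaObj R (ModuleCat.of R Y)).d 0 0 = 0 :=
      HomologicalComplex.shape _ _ _ (by simp)
    rw [h0]
    constructor
    · intro h
      refine ⟨fun f g => ?_⟩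
      rw [← sub_eq_zero]
      let φ : ((ChainComplex.single₀ (ModuleCat R)).obj (ModuleCat.of R X)).X 0 ⟶
        ModuleCat.of R Y := f - g
      change φ = 0
      obtain ⟨x, hx⟩ := (h (P.π.f 0 ≫ φ)).1 (by
        change P.complex.d 1 0 ≫ P.π.f 0 ≫ φ = 0
        rw [P.complex_d_comp_π_f_zero_assoc, zero_comp])
      rw [← cancel_epi (P.π.f 0), comp_zero]
      exact hx.symm
    · intro h f
      constructor
      · intro (hf : P.complex.d 1 0 ≫ f = 0)
        refine ⟨0, ?_⟩
        have hd := P.exact₀.g_desc f hf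
        have : P.exact₀.desc f hf = 0 :=
          Subsingleton.elim (α := ModuleCat.of R X ⟶ ModuleCat.of R Y) _ _
        rw [this, comp_zero] at hd
        exact hd
      · rintro ⟨x, rfl⟩
        exact (comp_zero : P.complex.d 1 0 ≫ (0 : P.complex.X 0 ⟶ ModuleCat.of R Y) = 0)
  | succ i =>
    rw [ModuleCat.isZero_homology_iff (i := i) (k := i + 2) _ (by simp) (by simp)]
    constructor
    · intro h
      refine subsingleton_of_forall_eq 0 fun e => ?_
      obtain ⟨f, hf, rfl⟩ := P.extMk_surjective e (i + 2) rfl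
      rw [P.extMk_eq_zero_iff _ _ _ _ i rfl]
      exact (h f).1 hf
    · intro h f
      constructor
      · intro hf
        exact (P.extMk_eq_zero_iff f (i + 2) rfl hf i rfl).1 (Subsingleton.elim _ _)
      · rintro ⟨g, rfl⟩
        let γ : P.complex.X i ⟶ ModuleCat.of R Y := g
        change P.complex.d (i + 2) (i + 1) ≫ P.complex.d (i + 1) i ≫ γ = 0
        simp

end Bridges

section Chase

variable {R : Type u} [CommRing R]

/-- Diagram chase: in a map of short exact rows with exact third column and commuting squares,
an element of the first column that becomes a boundary in the second one is a boundary. -/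
lemma exists_boundary_of_exact {A₁ A₀ B₂ B₁ B₀ C₂ C₁ C₀ : Type*}
    [AddCommGroup A₁] [AddCommGroup A₀] [AddCommGroup B₂] [AddCommGroup B₁] [AddCommGroup B₀]
    [AddCommGroup C₂] [AddCommGroup C₁] [AddCommGroup C₀]
    [Module R A₁] [Module R A₀] [Module R B₂] [Module R B₁] [Module R B₀]
    [Module R C₂] [Module R C₁] [Module R C₀]
    {a : A₁ →ₗ[R] A₀} {b₂ : B₂ →ₗ[R] B₁} {b : B₁ →ₗ[R] B₀} {c₂ : C₂ →ₗ[R] C₁} {c : C₁ →ₗ[R] C₀}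
    {f₁ : A₁ →ₗ[R] B₁} {f₀ : A₀ →ₗ[R] B₀} {g₂ : B₂ →ₗ[R] C₂} {g₁ : B₁ →ₗ[R] C₁}
    {g₀ : B₀ →ₗ[R] C₀}
    (hf : ∀ x, f₀ (a x) = b (f₁ x)) (hg₂ : ∀ x, g₁ (b₂ x) = c₂ (g₂ x))
    (hg : ∀ x, g₀ (b x) = c (g₁ x)) (hb : ∀ x, b (b₂ x) = 0)
    (hf₀ : Function.Injective f₀) (hfg₀ : ∀ x, g₀ (f₀ x) = 0)
    (hfg₁ : Function.Exact f₁ g₁) (hg₂s : Function.Surjective g₂) (hc : Function.Exact c₂ c)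
    {y : A₀} {z : B₁} (hz : b z = f₀ y) : ∃ x, a x = y := by
  obtain ⟨w, hw⟩ := (hc (g₁ z)).1 (by rw [← hg, hz, hfg₀])
  obtain ⟨v, rfl⟩ := hg₂s w
  obtain ⟨x, hx⟩ := (hfg₁ (z - b₂ v)).1 (by rw [map_sub, hg₂, hw, sub_self])
  refine ⟨x, hf₀ ?_⟩
  rw [hf, hx, map_sub, hb, sub_zero, hz]

variable {K F M : Type u} [AddCommGroup K] [Module R K] [AddCommGroup F] [Module R F]
  [AddCommGroup M] [Module R M] {f : K →ₗ[R] F} {g : F →ₗ[R] M}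
  (hf : Function.Injective f) (hfg : Function.Exact f g) (hg : Function.Surjective g)
  (N : Type u) [AddCommGroup N] [Module R N]

include hf hfg hg

lemma TorIndep.exists_lTensor_d_eq (h : TorIndep R M N)
    (P : ProjectiveResolution (ModuleCat.of R N)) (i : ℕ)
    {y : TensorProduct R K (P.complex.X i)} {z : TensorProduct R F (P.complex.X (i + 1))}
    (hz : (P.complex.d (i + 1) i).hom.lTensor F z = f.rTensor _ y) :
    ∃ x, (P.complex.d (i + 1) i).hom.lTensor K x = y := by
  have hproj (j : ℕ) : Module.Projective R (P.complex.X j) :=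
    (IsProjective.iff_projective _ ).2 (P.projective j)
  have hsq {X Y : Type u} [AddCommGroup X] [Module R X] [AddCommGroup Y] [Module R Y]
      (φ : X →ₗ[R] Y) (j : ℕ) (x) :
      φ.rTensor _ ((P.complex.d (j + 1) j).hom.lTensor X x) =
        (P.complex.d (j + 1) j).hom.lTensor Y (φ.rTensor _ x) := by
    rw [← LinearMap.comp_apply, ← LinearMap.comp_apply, LinearMap.rTensor_comp_lTensor,
      LinearMap.lTensor_comp_rTensor]
  refine exists_boundary_of_exact (b₂ := (P.complex.d (i + 2) (i + 1)).hom.lTensor F)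
    (b := (P.complex.d (i + 1) i).hom.lTensor F) (f₁ := f.rTensor _) (f₀ := f.rTensor _)
    (g₁ := g.rTensor _) (g₀ := g.rTensor _)
    (hsq f i) (hsq g (i + 1)) (hsq g i) (fun x => ?_)
    (Module.Flat.rTensor_preserves_injective_linearMap f hf) (fun x => ?_)
    (rTensor_exact _ hfg hg) (LinearMap.rTensor_surjective _ hg)
    ((subsingleton_torMod_succ_iff M N P i).1 (h (i + 1) (by omega))) hz
  · rw [← LinearMap.comp_apply, ← LinearMap.lTensor_comp, ← ModuleCat.hom_comp,
      P.complex.d_comp_d]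
    simp
  · rw [← LinearMap.comp_apply, ← LinearMap.rTensor_comp, hfg.linearMap_comp_eq_zero]
    simp

lemma TorIndep.of_exact [Module.Flat R F] (h : TorIndep R M N) : TorIndep R K N := by
  intro i hi
  obtain ⟨i, rfl⟩ := Nat.exists_eq_add_of_le' hi
  let P := projectiveResolution (ModuleCat.of R N)
  have hproj (j : ℕ) : Module.Projective R (P.complex.X j) :=
    (IsProjective.iff_projective _ ).2 (P.projective j)
  rw [subsingleton_torMod_succ_iff K N P i]
  intro y
  constructor
  · intro hy
    have hP : Function.Exact (P.complex.d (i + 2) (i + 1)).hom (P.complex.d (i + 1) i).hom :=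
      (ShortComplex.ShortExact.moduleCat_exact_iff_function_exact _).1 (P.exact_succ i)
    obtain ⟨z, hz⟩ := (Module.Flat.lTensor_exact F hP (f.rTensor _ y)).1 (by
      rw [← LinearMap.comp_apply, LinearMap.lTensor_comp_rTensor,
        ← LinearMap.rTensor_comp_lTensor, LinearMap.comp_apply, hy, map_zero])
    exact h.exists_lTensor_d_eq hf hfg hg N P (i + 1) hz
  · rintro ⟨x, rfl⟩
    rw [← LinearMap.comp_apply, ← LinearMap.lTensor_comp, ← ModuleCat.hom_comp,
      P.complex.d_comp_d]
    simp

lemma TorIndep.rTensor_injective (h : TorIndep R M N) : Function.Injective (f.rTensor N) := by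
  let P := projectiveResolution (ModuleCat.of R N)
  let ε : P.complex.X 0 →ₗ[R] N := (P.π.f 0).hom
  have hε : Function.Surjective ε := (ModuleCat.epi_iff_surjective (P.π.f 0)).1 inferInstance
  have hex : Function.Exact (P.complex.d 1 0).hom ε :=
    (ShortComplex.ShortExact.moduleCat_exact_iff_function_exact _).1 P.exact₀
  rw [injective_iff_map_eq_zero]
  intro x hx
  obtain ⟨y, rfl⟩ := LinearMap.lTensor_surjective K hε x
  obtain ⟨z, hz⟩ := (lTensor_exact F hex hε (f.rTensor _ y)).1 (by
    rw [← LinearMap.comp_apply, LinearMap.lTensor_comp_rTensor,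
      ← LinearMap.rTensor_comp_lTensor, LinearMap.comp_apply, hx])
  obtain ⟨w, rfl⟩ := h.exists_lTensor_d_eq hf hfg hg N P 0 hz
  rw [← LinearMap.comp_apply, ← LinearMap.lTensor_comp, hex.linearMap_comp_eq_zero]
  simp

end Chase

section ExtVanishing

variable {R : Type u} [CommRing R]

lemma CategoryTheory.Abelian.Ext.comp_mk₀_eq_zero_of_mem_annihilator_smul {k : ModuleCat.{u} R}
    {X Y : Type u} [AddCommGroup X] [Module R X] [AddCommGroup Y] [Module R Y] {I : Ideal R} (hI : I ≤ Module.annihilator R k) {φ : X →ₗ[R] Y}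
    (hφ : φ ∈ I • (⊤ : Submodule R (X →ₗ[R] Y))) {i : ℕ} (e : Ext k (ModuleCat.of R X) i) :
    e.comp (Ext.mk₀ (ModuleCat.ofHom φ)) (add_zero i) = 0 := by
  induction hφ using Submodule.smul_induction_on' with
  | smul r hr ψ _ =>
    have hr0 : r • 𝟙 k = 0 := by
      ext x
      exact Module.mem_annihilator.1 (hI hr) x
    have hre : r • e = 0 := by
      have : r • e = (Ext.mk₀ (r • 𝟙 k)).comp e (zero_add i) := by simp [Ext.mk₀_smul]
      rw [this, hr0, Ext.mk₀_zero, Ext.zero_comp]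
    rw [show ModuleCat.ofHom (r • ψ) = r • ModuleCat.ofHom ψ from rfl, Ext.mk₀_smul, Ext.comp_smul, ← Ext.smul_comp, hre, Ext.zero_comp]
  | add x _ y _ hx hy =>
    rw [ModuleCat.ofHom_add, Ext.mk₀_add, Ext.comp_add, hx, hy, add_zero]

lemma Module.mem_smul_top_of_range_le {K F : Type*} [AddCommGroup K] [Module R K]
    [AddCommGroup F] [Module R F] [Module.Free R K] [Module.Finite R K] {I : Ideal R}
    {f : K →ₗ[R] F} (hf : ∀ x, f x ∈ I • (⊤ : Submodule R F)) :
    f ∈ I • (⊤ : Submodule R (K →ₗ[R] F)) := by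
  let b := Module.Free.chooseBasis R K
  have hsum : f = ∑ j, (b.coord j).smulRight (f (b j)) := by
    refine b.ext fun l => ?_
    simp [LinearMap.sum_apply, Finsupp.single_apply, ite_smul]
  rw [hsum]
  refine Submodule.sum_mem _ fun j _ => ?_
  generalize hy : f (b j) = y
  have hj := hy ▸ hf (b j)
  clear hy
  induction hj using Submodule.smul_induction_on' with
  | smul r hr x _ =>
    have : (b.coord j).smulRight (r • x) = r • (b.coord j).smulRight x := by
      ext y
      exact smul_comm _ _ _
    rw [this]
    exact Submodule.smul_mem_smul hr trivial
  | add x _ y _ hx hy =>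
    have : (b.coord j).smulRight (x + y) = (b.coord j).smulRight x + (b.coord j).smulRight y := by
      ext y
      simp
    rw [this]
    exact add_mem hx hy

lemma LinearMap.rTensor_mem_smul_top {K F : Type*} [AddCommGroup K] [Module R K]
    [AddCommGroup F] [Module R F] (N : Type*) [AddCommGroup N] [Module R N] {I : Ideal R}
    {f : K →ₗ[R] F} (hf : f ∈ I • (⊤ : Submodule R (K →ₗ[R] F))) :
    f.rTensor N ∈ I • (⊤ : Submodule R (TensorProduct R K N →ₗ[R] TensorProduct R F N)) := by
  induction hf using Submodule.smul_induction_on' with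
  | smul r hr x _ =>
    rw [LinearMap.rTensor_smul]
    exact Submodule.smul_mem_smul hr trivial
  | add x _ y _ hx hy =>
    rw [LinearMap.rTensor_add]
    exact add_mem hx hy

lemma CategoryTheory.Abelian.Ext.subsingleton_of_retract {k X Y : ModuleCat.{u} R} (r : Retract X Y) {i : ℕ}
    (h : Subsingleton (Ext k Y i)) : Subsingleton (Ext k X i) := by
  refine subsingleton_of_forall_eq 0 fun e => ?_
  have : (e.comp (Ext.mk₀ r.i) (add_zero i)).comp (Ext.mk₀ r.r) (add_zero i) = e := by
    simp [Ext.mk₀_comp_mk₀]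
  rw [← this, Subsingleton.elim (e.comp (Ext.mk₀ r.i) (add_zero i)) 0, Ext.zero_comp]

lemma CategoryTheory.Abelian.Ext.subsingleton_congr_of_linearEquiv {k : ModuleCat.{u} R} {X Y : Type u}
    [AddCommGroup X] [Module R X] [AddCommGroup Y] [Module R Y] (e : X ≃ₗ[R] Y) (i : ℕ) :
    Subsingleton (Ext k (ModuleCat.of R X) i) ↔ Subsingleton (Ext k (ModuleCat.of R Y) i) :=
  ⟨subsingleton_of_retract (Retract.ofIso e.symm.toModuleIso),
    subsingleton_of_retract (Retract.ofIso e.toModuleIso)⟩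

lemma CategoryTheory.Abelian.Ext.subsingleton_tensorProduct_iff_of_free (k : ModuleCat.{u} R) (F N : Type u)
    [AddCommGroup F] [Module R F] [AddCommGroup N] [Module R N] [Module.Free R F]
    [Module.Finite R F] [Nontrivial F] (i : ℕ) :
    Subsingleton (Ext k (ModuleCat.of R (TensorProduct R F N)) i) ↔
      Subsingleton (Ext k (ModuleCat.of R N) i) := by
  let b := Module.Free.chooseBasis R F
  let ι (j) : N →ₗ[R] TensorProduct R F N := TensorProduct.mk R F N (b j)
  let π (j) : TensorProduct R F N →ₗ[R] N :=
    (TensorProduct.lid R N).toLinearMap ∘ₗ (b.coord j).rTensor N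
  constructor
  · obtain ⟨j⟩ := b.index_nonempty
    refine subsingleton_of_retract
      ⟨ModuleCat.ofHom (ι j), ModuleCat.ofHom (π j), ?_⟩
    ext x
    simp [ι, π]
  · intro h
    refine subsingleton_of_forall_eq 0 fun e => ?_
    have hid : 𝟙 (ModuleCat.of R (TensorProduct R F N)) =
        ∑ j, ModuleCat.ofHom (π j) ≫ ModuleCat.ofHom (ι j) := by
      ext x y
      simp [ι, π, ModuleCat.hom_sum, LinearMap.sum_apply, TensorProduct.smul_tmul',
        ← TensorProduct.sum_tmul, b.sum_repr]
    rw [← Ext.comp_mk₀_id e, hid, Ext.mk₀_sum, Ext.comp_sum]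
    refine Finset.sum_eq_zero fun j _ => ?_
    rw [← Ext.mk₀_comp_mk₀, ← Ext.comp_assoc_of_third_deg_zero,
      Subsingleton.elim (e.comp (Ext.mk₀ (ModuleCat.ofHom (π j))) (add_zero i)) 0, Ext.zero_comp]

end ExtVanishing

section FirstNonvanishing

/-- The least index at which a family of propositions fails. -/
noncomputable def firstFailure (V : ℕ → Prop) : ℕ∞ :=
  sInf {n : ℕ∞ | ∃ i : ℕ, n = (i : ℕ∞) ∧ ¬ V i}

lemma le_firstFailure_iff {V : ℕ → Prop} {n : ℕ∞} :
    n ≤ firstFailure V ↔ ∀ i : ℕ, (i : ℕ∞) < n → V i := by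
  simp only [firstFailure, le_sInf_iff, Set.mem_ofPred_eq, forall_exists_index, and_imp]
  constructor
  · intro h i hi
    by_contra hV
    exact absurd (h _ i rfl hV) (not_le.2 hi)
  · rintro h _ i rfl hV
    by_contra hi
    exact hV (h i (not_le.1 hi))

lemma not_of_firstFailure_eq {V : ℕ → Prop} {n : ℕ} (h : firstFailure V = n) : ¬ V n := by
  intro hV
  have : ((n + 1 : ℕ) : ℕ∞) ≤ firstFailure V := le_firstFailure_iff.2 fun i hi => by
    obtain hi | rfl := Nat.lt_succ_iff_lt_or_eq.1 (Nat.cast_lt.1 hi)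
    · exact le_firstFailure_iff.1 h.ge i (Nat.cast_lt.2 hi)
    · exact hV
  rw [h, Nat.cast_le] at this
  omega

lemma of_lt_firstFailure {V : ℕ → Prop} {n : ℕ} (h : (n : ℕ∞) < firstFailure V) : V n :=
  le_firstFailure_iff.1 le_rfl n h

lemma firstFailure_eq_of {V : ℕ → Prop} {n : ℕ} (h : ∀ i < n, V i) (hn : ¬ V n) :
    firstFailure V = n :=
  le_antisymm (not_lt.1 fun h => hn (of_lt_firstFailure h))
    (le_firstFailure_iff.2 fun i hi => h i (Nat.cast_lt.1 hi))

/-- The numerical content of the long exact sequence for `0 → A → B → C → 0` when `A` has depth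
`q` less than `B`. -/
lemma firstFailure_add_one {A B C : ℕ → Prop} {q : ℕ}
    (hAB : firstFailure A + q = firstFailure B)
    (hC : ∀ i, B i → A (i + 1) → C i) (h0 : B 0 ∨ q = 0 → A 0)
    (hA : ∀ i, C i → B (i + 1) ∨ q = 0 → A (i + 1)) :
    firstFailure C + 1 = firstFailure A := by
  have hle : firstFailure A ≤ firstFailure B := hAB ▸ le_self_add
  generalize ha : firstFailure A = a
  rw [ha] at hAB hle
  induction a with
  | top =>
    rw [show firstFailure C = ⊤ from top_le_iff.1 (le_firstFailure_iff.2 fun i _ =>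
      hC i (of_lt_firstFailure (lt_of_lt_of_le (ENat.natCast_lt_top _) hle))
        (of_lt_firstFailure (ha ▸ ENat.natCast_lt_top _)))]
    rfl
  | coe a =>
    have hBq : B a ∨ q = 0 := by
      rcases Nat.eq_zero_or_pos q with hq | hq
      · exact Or.inr hq
      · refine Or.inl (of_lt_firstFailure ?_)
        rw [← hAB]
        exact_mod_cast Nat.lt_add_of_pos_right hq
    have hna := not_of_firstFailure_eq ha
    cases a with
    | zero => exact absurd (h0 hBq) hna
    | succ a =>
      rw [firstFailure_eq_of (n := a) (fun i hi => hC i ?_ ?_) fun hCa => hna (hA a hCa hBq)]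
      · norm_cast
      · exact of_lt_firstFailure (lt_of_lt_of_le (Nat.cast_lt.2 (by omega)) hle)
      · exact of_lt_firstFailure (ha ▸ Nat.cast_lt.2 (by omega))

lemma firstFailure_ext_add_one_of_exact {R : Type u} [CommRing R] {k : ModuleCat.{u} R}
    {I : Ideal R} (hk : I ≤ Module.annihilator R k)
    {A B C : Type u} [AddCommGroup A] [Module R A] [AddCommGroup B]
    [Module R B] [AddCommGroup C] [Module R C] {f : A →ₗ[R] B} {g : B →ₗ[R] C}
    (hf : Function.Injective f) (hfg : Function.Exact f g) (hg : Function.Surjective g) {q : ℕ}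
    (hAB : firstFailure (fun i => Subsingleton (Abelian.Ext k (ModuleCat.of R A) i)) + q =
      firstFailure (fun i => Subsingleton (Abelian.Ext k (ModuleCat.of R B) i)))
    (hq : q = 0 → f ∈ I • (⊤ : Submodule R (A →ₗ[R] B))) :
    firstFailure (fun i => Subsingleton (Abelian.Ext k (ModuleCat.of R C) i)) + 1 =
      firstFailure (fun i => Subsingleton (Abelian.Ext k (ModuleCat.of R A) i)) := by
  have hS := ModuleCat.shortComplex_shortExact
    (ModuleCat.shortComplexOfCompEqZero f g hfg.linearMap_comp_eq_zero) hfg hf hg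
  have key {i : ℕ} (h : Subsingleton (Ext k (ModuleCat.of R B) i) ∨ q = 0)
      (e : Ext k (ModuleCat.of R A) i) :
      e.comp (Ext.mk₀ (ModuleCat.ofHom f)) (add_zero i) = 0 := by
    rcases h with h | h
    · exact h.elim _ _
    · exact Ext.comp_mk₀_eq_zero_of_mem_annihilator_smul hk (hq h) e
  refine firstFailure_add_one hAB (fun i hB hA => ?_) (fun h => ?_) (fun i hC h => ?_)
  · refine subsingleton_of_forall_eq 0 fun e => ?_
    obtain ⟨x, rfl⟩ := Ext.covariant_sequence_exact₃ k hS e rfl (hA.elim _ _)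
    rw [show x = 0 from hB.elim _ _, Ext.zero_comp]
  · refine subsingleton_of_forall_eq 0 fun e => ?_
    have := hS.mono_f
    exact Ext.postcomp_mk₀_injective_of_mono k (ModuleCat.ofHom f)
      ((key h e).trans (map_zero _).symm)
  · refine subsingleton_of_forall_eq 0 fun e => ?_
    obtain ⟨x, rfl⟩ := Ext.covariant_sequence_exact₁ k hS e (key h e) rfl
    rw [show x = 0 from hC.elim _ _, Ext.zero_comp]

end FirstNonvanishing

section Main

variable {R : Type u} [CommRing R] [IsLocalRing R]

lemma eDepth_eq_firstFailure (X : Type u) [AddCommGroup X] [Module R X] :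
    eDepth R X = firstFailure fun i => Subsingleton
      (Abelian.Ext (ModuleCat.of R (IsLocalRing.ResidueField R)) (ModuleCat.of R X) i) := by
  simp only [eDepth, firstFailure, ← subsingleton_extMod_iff_exact, not_subsingleton_iff_nontrivial]

lemma eDepth_congr {X Y : Type u} [AddCommGroup X] [Module R X] [AddCommGroup Y] [Module R Y]
    (e : X ≃ₗ[R] Y) : eDepth R X = eDepth R Y := by
  simp only [eDepth_eq_firstFailure, Ext.subsingleton_congr_of_linearEquiv e]

lemma eDepth_tensorProduct_of_free (F N : Type u) [AddCommGroup F] [Module R F]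
    [AddCommGroup N] [Module R N] [Module.Free R F] [Module.Finite R F] [Nontrivial F] :
    eDepth R (TensorProduct R F N) = eDepth R N := by
  simp only [eDepth_eq_firstFailure, Ext.subsingleton_tensorProduct_iff_of_free]

lemma maximalIdeal_le_annihilator_residueField :
    IsLocalRing.maximalIdeal R ≤
      Module.annihilator R (ModuleCat.of R (IsLocalRing.ResidueField R)) := by
  intro r hr
  rw [Module.mem_annihilator]
  intro (x : IsLocalRing.ResidueField R)
  change r • x = 0
  rw [Algebra.smul_def]
  have : algebraMap R (IsLocalRing.ResidueField R) r = 0 :=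
    (IsLocalRing.residue_eq_zero_iff r).2 hr
  rw [this, zero_mul]

/-- If `0 → A → B → C → 0` is exact, `depth A + q = depth B`, and `A → B` has entries in the
maximal ideal when `q = 0`, then `depth C = depth A - 1`. -/
lemma eDepth_add_one_of_exact {A B C : Type u} [AddCommGroup A] [Module R A] [AddCommGroup B]
    [Module R B] [AddCommGroup C] [Module R C] {f : A →ₗ[R] B} {g : B →ₗ[R] C}
    (hf : Function.Injective f) (hfg : Function.Exact f g) (hg : Function.Surjective g) {q : ℕ}
    (hAB : eDepth R A + q = eDepth R B)
    (hq : q = 0 → f ∈ IsLocalRing.maximalIdeal R • (⊤ : Submodule R (A →ₗ[R] B))) :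
    eDepth R C + 1 = eDepth R A := by
  simp only [eDepth_eq_firstFailure] at hAB ⊢
  exact firstFailure_ext_add_one_of_exact maximalIdeal_le_annihilator_residueField
    hf hfg hg hAB hq

lemma exists_minimal_cover (M : Type u) [AddCommGroup M] [Module R M] [Module.Finite R M] :
    ∃ (n : ℕ) (g : (Fin n → R) →ₗ[R] M), Function.Surjective g ∧
      LinearMap.ker g ≤ IsLocalRing.maximalIdeal R • ⊤ := by
  let b := Module.finBasis (IsLocalRing.ResidueField R)
    (TensorProduct R (IsLocalRing.ResidueField R) M)
  obtain ⟨v, hv⟩ := (TensorProduct.mk_surjective R M (IsLocalRing.ResidueField R)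
    Ideal.Quotient.mk_surjective).comp_left b
  refine ⟨_, Fintype.linearCombination R v, ?_, fun x hx => ?_⟩
  · rw [← LinearMap.range_eq_top, Fintype.range_linearCombination]
    exact IsLocalRing.span_eq_top_of_tmul_eq_basis v b (congr_fun hv)
  · have hsum : ∑ j, IsLocalRing.residue R (x j) • b j = 0 := by
      have h := congrArg (TensorProduct.mk R (IsLocalRing.ResidueField R) M 1)
        (LinearMap.mem_ker.1 hx)
      rw [Fintype.linearCombination_apply, map_sum, map_zero] at h
      rw [← h]
      refine Finset.sum_congr rfl fun j _ => ?_
      rw [map_smul, ← congr_fun hv j]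
      exact (algebraMap_smul (IsLocalRing.ResidueField R) (x j) _)
    have hmem (j) : x j ∈ IsLocalRing.maximalIdeal R :=
      (IsLocalRing.residue_eq_zero_iff _).1
        (Fintype.linearIndependent_iff.1 b.linearIndependent _ hsum j)
    rw [pi_eq_sum_univ' x]
    exact Submodule.sum_mem _ fun j _ => Submodule.smul_mem_smul (hmem j) trivial

variable [IsNoetherianRing R]

/-- A module of finite projective dimension lowers the depth of every Tor-independent module by
a fixed amount, which is positive unless the module is free. -/
lemma exists_eDepth_tensorProduct_add_eq (n : ℕ) (M : Type u) [AddCommGroup M] [Module R M]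
    [Module.Finite R M] [Nontrivial M] (hM : HasProjectiveDimensionLT (ModuleCat.of R M) (n + 1)) :
    ∃ p : ℕ, (p = 0 → Module.Free R M) ∧
      ∀ (N : Type u) [AddCommGroup N] [Module R N], TorIndep R M N →
        eDepth R (TensorProduct R M N) + p = eDepth R N := by
  induction n generalizing M with
  | zero =>
    have : Module.Projective R M := (IsProjective.iff_projective _).2
      (projective_iff_hasProjectiveDimensionLT_one.2 hM)
    have : Module.Free R M := Module.free_of_flat_of_isLocalRing
    exact ⟨0, fun _ => this, fun N _ _ _ => by simp [eDepth_tensorProduct_of_free]⟩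
  | succ n ih =>
    obtain ⟨m, g, hg, hker⟩ := exists_minimal_cover M (R := R)
    have : Nontrivial (Fin m → R) := hg.nontrivial
    rcases subsingleton_or_nontrivial (LinearMap.ker g) with hK | hK
    · have : Module.Free R M := .of_equiv
        (LinearEquiv.ofBijective g ⟨LinearMap.ker_eq_bot.1
          (Submodule.subsingleton_iff_eq_bot.1 hK), hg⟩)
      exact ⟨0, fun _ => this, fun N _ _ _ => by simp [eDepth_tensorProduct_of_free]⟩
    · let f := (LinearMap.ker g).subtype
      have hf : Function.Injective f := Subtype.val_injective
      have hfg : Function.Exact f g := g.exact_subtype_ker_map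
      have hpd := ((LinearMap.shortExact_shortComplexKer hg).hasProjectiveDimensionLT_X₃_iff n
        ((IsProjective.iff_projective _).1 inferInstance)).1 hM
      obtain ⟨q, hq0, hq⟩ := ih (LinearMap.ker g) hpd
      refine ⟨q + 1, fun h => absurd h q.succ_ne_zero, fun N _ _ hN => ?_⟩
      have hAB := hq N (hN.of_exact hf hfg hg N)
      have hC := eDepth_add_one_of_exact (hN.rTensor_injective hf hfg hg N)
        (rTensor_exact N hfg hg) (LinearMap.rTensor_surjective N hg)
        (hAB.trans (eDepth_tensorProduct_of_free (Fin m → R) N).symm) fun h => by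
          have := hq0 h
          exact LinearMap.rTensor_mem_smul_top N
            (Module.mem_smul_top_of_range_le fun x => hker x.2)
      rw [← hAB, ← hC]
      push_cast
      ring

omit [IsLocalRing R] [IsNoetherianRing R] in
lemma IsSyzygy.hasProjectiveDimensionLT {n : ℕ} {M K : ModuleCat.{u} R} (h : IsSyzygy R n M K)
    {m : ℕ} (hK : HasProjectiveDimensionLT K (m + 1)) :
    HasProjectiveDimensionLT M (n + m + 1) := by
  induction h generalizing m with
  | zero M K e => simpa using hasProjectiveDimensionLT_of_iso e (m + 1)
  | succ n M M' K F hfree hfin f g hf hfg hg hM' ih =>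
    have hS := ModuleCat.shortComplex_shortExact
      (ShortComplex.mk f g (by ext x; exact hfg.apply_apply_eq_zero x)) hfg hf hg
    have := ih ((hS.hasProjectiveDimensionLT_X₃_iff m
      ((IsProjective.iff_projective F).1 Module.Projective.of_free)).2 hK)
    rwa [show n + 1 + m + 1 = n + (m + 1) + 1 from by omega]

omit [IsLocalRing R] [IsNoetherianRing R] in
lemma TorIndep.self_right (M : Type u) [AddCommGroup M] [Module R M] : TorIndep R M R := by
  intro i hi
  obtain ⟨i, rfl⟩ := Nat.exists_eq_add_of_le' hi
  have : Projective (ModuleCat.of R R) := (IsProjective.iff_projective _).1 inferInstance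
  exact ModuleCat.isZero_iff_subsingleton.1 
    (isZero_Tor_succ_of_projective _ (ModuleCat.of R M) (ModuleCat.of R R) i)

end Main

/-- Auslander's depth formula: if `M`, `N` are Tor-independent and `M` has
finite projective dimension, then `depth M + depth N = depth R + depth (M ⊗_R N)`. -/
theorem stmt_9 (R : Type u) [CommRing R] [IsNoetherianRing R] [IsLocalRing R]
    (M N : Type u) [AddCommGroup M] [Module R M] [AddCommGroup N] [Module R N]
    [Module.Finite R M] [Module.Finite R N] [Nontrivial M] [Nontrivial N]
    (hTI : TorIndep R M N)
    (hpd : ∃ (n : ℕ) (K : ModuleCat.{u} R),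
      IsSyzygy R n (ModuleCat.of R M) K ∧ Module.Projective R K) :
    eDepth R M + eDepth R N = eDepth R R + eDepth R (TensorProduct R M N) := by
  obtain ⟨n, K, hK, hproj⟩ := hpd
  have : Projective K := (IsProjective.iff_projective K).1 hproj
  obtain ⟨p, -, hp⟩ := exists_eDepth_tensorProduct_add_eq n M
    (hK.hasProjectiveDimensionLT (m := 0) inferInstance)
  rw [← hp N hTI, ← hp R (.self_right M), eDepth_congr (TensorProduct.rid R M), add_right_comm,
    add_assoc]
end

section
/- Let (R, m) be a commutative Noetherian local ring, M a finitely generated R-module of finite Gorenstein dimension, and x ∈ m an element regular on both R and M. Then G-dim_R(M/xM) = G-dim_R(M) + 1 and G-dim_{R/xR}(M/xM) = G-dim_R(M). -/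
open CategoryTheory

universe u

/-- A totally reflexive module: finitely generated, reflexive, and
`Ext^i(M,R) = Ext^i(M*,R) = 0` for all `i ≥ 1`. -/
def TotReflexive (R : Type u) [CommRing R]
    (M : Type u) [AddCommGroup M] [Module R M] : Prop :=
  Module.Finite R M ∧ Module.IsReflexive R M ∧
    (∀ i : ℕ, 1 ≤ i → Subsingleton (extMod R i M R)) ∧
    (∀ i : ℕ, 1 ≤ i → Subsingleton (extMod R i (Module.Dual R M) R))

/-- `GdimLE R n M` : `M` admits a resolution of length `n` by totally reflexive modules. -/
inductive GdimLE (R : Type u) [CommRing R] : ℕ → ModuleCat.{u} R → Prop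
  | zero (M : ModuleCat.{u} R) (h : TotReflexive R M) : GdimLE R 0 M
  | succ (n : ℕ) (M K G : ModuleCat.{u} R) (hG : TotReflexive R G)
      (f : K ⟶ G) (g : G ⟶ M)
      (hf : Function.Injective f) (hfg : Function.Exact f g) (hg : Function.Surjective g)
      (hK : GdimLE R n K) : GdimLE R (n + 1) M

/-- Gorenstein dimension (Auslander–Bridger) of a module, as an extended natural number. -/
noncomputable def gdim (R : Type u) [CommRing R] (M : ModuleCat.{u} R) : ℕ∞ :=
  sInf {n : ℕ∞ | ∃ k : ℕ, n = (k : ℕ∞) ∧ GdimLE R k M}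

section ExtVanishing

variable (R : Type u) [CommRing R]

/-- Vanishing of the `i`-th `Ext` group, computed in the derived category. -/
def ExtVanish (i : ℕ) (M N : Type u) [AddCommGroup M] [Module R M]
    [AddCommGroup N] [Module R N] : Prop :=
  Subsingleton (Abelian.Ext.{u} (ModuleCat.of R M) (ModuleCat.of R N) i)

variable {R}

lemma ProjectiveResolution.subsingleton_ext_succ_iff {X : ModuleCat.{u} R}
    (P : ProjectiveResolution X) (Y : ModuleCat.{u} R) (n : ℕ) :
    Subsingleton (Abelian.Ext.{u} X Y (n + 1)) ↔
      ∀ f : P.complex.X (n + 1) ⟶ Y, P.complex.d (n + 2) (n + 1) ≫ f = 0 →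
        ∃ g : P.complex.X n ⟶ Y, P.complex.d (n + 1) n ≫ g = f := by
  refine ⟨fun h f hf ↦ ?_, fun h ↦ subsingleton_of_forall_eq 0 fun α ↦ ?_⟩
  · exact (P.extMk_eq_zero_iff f (n + 2) rfl hf n rfl).1 (Subsingleton.elim _ _)
  · obtain ⟨f, hf, rfl⟩ := P.extMk_surjective α (n + 2) rfl
    exact (P.extMk_eq_zero_iff f (n + 2) rfl hf n rfl).2 (h f hf)

lemma extMod_succ_subsingleton_iff (n : ℕ) (M N : Type u) [AddCommGroup M] [Module R M]
    [AddCommGroup N] [Module R N] :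
    Subsingleton (extMod R (n + 1) M N) ↔ ExtVanish R (n + 1) M N := by
  let P := projectiveResolution (ModuleCat.of R M)
  rw [ExtVanish, ProjectiveResolution.subsingleton_ext_succ_iff P, extMod,
    ← ModuleCat.isZero_iff_subsingleton, (P.isoExt (n + 1) (ModuleCat.of R N)).isZero_iff,
    ← HomologicalComplex.exactAt_iff_isZero_homology,
    HomologicalComplex.exactAt_iff' _ n (n + 1) (n + 2) (by simp) (by simp),
    ShortComplex.moduleCat_exact_iff]
  rfl

variable {A B C M N N' : Type u} [AddCommGroup A] [Module R A] [AddCommGroup B] [Module R B]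
  [AddCommGroup C] [Module R C] [AddCommGroup M] [Module R M] [AddCommGroup N] [Module R N]
  [AddCommGroup N'] [Module R N']

lemma LinearMap.shortExact_of_exact {f : A →ₗ[R] B} {g : B →ₗ[R] C} (hf : Function.Injective f)
    (hfg : Function.Exact f g) (hg : Function.Surjective g) :
    (ModuleCat.shortComplexOfCompEqZero f g hfg.linearMap_comp_eq_zero).ShortExact where
  exact := ModuleCat.shortComplex_exact _ hfg
  mono_f := (ModuleCat.mono_iff_injective _).2 hf
  epi_g := (ModuleCat.epi_iff_surjective _).2 hg

namespace ExtVanish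

lemma middle {f : A →ₗ[R] B} {g : B →ₗ[R] C} (hf : Function.Injective f)
    (hfg : Function.Exact f g) (hg : Function.Surjective g) {i : ℕ}
    (hA : ExtVanish R i A N) (hC : ExtVanish R i C N) : ExtVanish R i B N := by
  have hS := LinearMap.shortExact_of_exact hf hfg hg
  refine subsingleton_of_forall_eq 0 fun β ↦ ?_
  obtain ⟨γ, rfl⟩ := Abelian.Ext.contravariant_sequence_exact₂ hS _ β (hA.elim _ _)
  rw [hC.elim γ 0]
  simp

lemma right {f : A →ₗ[R] B} {g : B →ₗ[R] C} (hf : Function.Injective f)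
    (hfg : Function.Exact f g) (hg : Function.Surjective g) {i : ℕ}
    (hA : ExtVanish R i A N) (hB : ExtVanish R (i + 1) B N) : ExtVanish R (i + 1) C N := by
  have hS := LinearMap.shortExact_of_exact hf hfg hg
  refine subsingleton_of_forall_eq 0 fun γ ↦ ?_
  obtain ⟨α, rfl⟩ := Abelian.Ext.contravariant_sequence_exact₃ hS _ γ (hB.elim _ _)
    (add_comm 1 i)
  rw [hA.elim α 0]
  simp

lemma left {f : A →ₗ[R] B} {g : B →ₗ[R] C} (hf : Function.Injective f)
    (hfg : Function.Exact f g) (hg : Function.Surjective g) {i : ℕ}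
    (hB : ExtVanish R i B N) (hC : ExtVanish R (i + 1) C N) : ExtVanish R i A N := by
  have hS := LinearMap.shortExact_of_exact hf hfg hg
  refine subsingleton_of_forall_eq 0 fun α ↦ ?_
  obtain ⟨β, rfl⟩ := Abelian.Ext.contravariant_sequence_exact₁ hS _ α (add_comm 1 i)
    (hC.elim _ _)
  rw [hB.elim β 0]
  simp

lemma exists_extension {f : A →ₗ[R] B} {g : B →ₗ[R] C} (hf : Function.Injective f)
    (hfg : Function.Exact f g) (hg : Function.Surjective g)
    (hC : ExtVanish R 1 C N) (φ : A →ₗ[R] N) : ∃ ψ : B →ₗ[R] N, ψ ∘ₗ f = φ := by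
  have hS := LinearMap.shortExact_of_exact hf hfg hg
  obtain ⟨β, hβ⟩ := Abelian.Ext.contravariant_sequence_exact₁ hS _
    (Abelian.Ext.mk₀ (ModuleCat.ofHom φ)) (add_zero 1) (hC.elim _ _)
  obtain ⟨ψ, rfl⟩ := (Abelian.Ext.mk₀_bijective _ _).2 β
  rw [Abelian.Ext.mk₀_comp_mk₀] at hβ
  exact ⟨ψ.hom, congrArg ModuleCat.Hom.hom ((Abelian.Ext.mk₀_bijective _ _).1 hβ)⟩

lemma one_of_exists_extension {f : A →ₗ[R] B} {g : B →ₗ[R] C} (hf : Function.Injective f)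
    (hfg : Function.Exact f g) (hg : Function.Surjective g) (hB : ExtVanish R 1 B N)
    (h : ∀ φ : A →ₗ[R] N, ∃ ψ : B →ₗ[R] N, ψ ∘ₗ f = φ) : ExtVanish R 1 C N := by
  have hS := LinearMap.shortExact_of_exact hf hfg hg
  refine subsingleton_of_forall_eq 0 fun γ ↦ ?_
  obtain ⟨α, rfl⟩ := Abelian.Ext.contravariant_sequence_exact₃ hS _ γ (hB.elim _ _) (add_zero 1)
  obtain ⟨φ, rfl⟩ := (Abelian.Ext.mk₀_bijective _ _).2 α
  obtain ⟨ψ, hψ⟩ := h φ.hom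
  have : φ = (ModuleCat.shortComplexOfCompEqZero f g hfg.linearMap_comp_eq_zero).f ≫
      ModuleCat.ofHom ψ := by
    ext a
    exact (LinearMap.congr_fun hψ a).symm
  rw [this, ← Abelian.Ext.mk₀_comp_mk₀, hS.extClass_comp_assoc]

lemma of_projective [Module.Projective R M] (i : ℕ) : ExtVanish R (i + 1) M N :=
  have : Projective (ModuleCat.of R M) := (IsProjective.iff_projective M).1 inferInstance
  Abelian.Ext.subsingleton_of_projective _ _ _

lemma codomain_right {f : A →ₗ[R] B} {g : B →ₗ[R] C} (hf : Function.Injective f)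
    (hfg : Function.Exact f g) (hg : Function.Surjective g) {i : ℕ}
    (hB : ExtVanish R i M B) (hA : ExtVanish R (i + 1) M A) : ExtVanish R i M C := by
  have hS := LinearMap.shortExact_of_exact hf hfg hg
  refine subsingleton_of_forall_eq 0 fun γ ↦ ?_
  obtain ⟨β, rfl⟩ := Abelian.Ext.covariant_sequence_exact₃ _ hS γ rfl (hA.elim _ _)
  rw [hB.elim β 0]
  simp

lemma exists_lift {f : A →ₗ[R] B} {g : B →ₗ[R] C} (hf : Function.Injective f)
    (hfg : Function.Exact f g) (hg : Function.Surjective g)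
    (hA : ExtVanish R 1 M A) (φ : M →ₗ[R] C) : ∃ ψ : M →ₗ[R] B, g ∘ₗ ψ = φ := by
  have hS := LinearMap.shortExact_of_exact hf hfg hg
  obtain ⟨β, hβ⟩ := Abelian.Ext.covariant_sequence_exact₃ _ hS
    (Abelian.Ext.mk₀ (ModuleCat.ofHom φ)) (zero_add 1) (hA.elim _ _)
  obtain ⟨ψ, rfl⟩ := (Abelian.Ext.mk₀_bijective _ _).2 β
  rw [Abelian.Ext.mk₀_comp_mk₀] at hβ
  exact ⟨ψ.hom, congrArg ModuleCat.Hom.hom ((Abelian.Ext.mk₀_bijective _ _).1 hβ)⟩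

section Local

variable [IsNoetherianRing R] [IsLocalRing R] {x : R}

lemma of_forall_exists_smul [Module.Finite R M] [Module.Finite R N]
    (hx : x ∈ IsLocalRing.maximalIdeal R) {i : ℕ}
    (h : ∀ α : Abelian.Ext.{u} (ModuleCat.of R M) (ModuleCat.of R N) i, ∃ β, x • β = α) :
    ExtVanish R i M N := by
  rw [ExtVanish, ← Submodule.subsingleton_iff R, ← subsingleton_iff_bot_eq_top, eq_comm]
  refine Submodule.eq_bot_of_le_smul_of_le_jacobson_bot (Ideal.span {x}) ⊤ Module.Finite.fg_top
    (fun α _ ↦ ?_) ?_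
  · obtain ⟨β, rfl⟩ := h α
    exact Submodule.smul_mem_smul (Ideal.mem_span_singleton_self x) trivial
  · rw [Ideal.span_singleton_le_iff_mem, IsLocalRing.jacobson_eq_maximalIdeal _ bot_ne_top]
    exact hx

/-- If `0 → M → M → M' → 0` is exact with first map `x`, then vanishing of `Ext^{i+1}(M', N)`
forces that of `Ext^i(M, N)`. -/
lemma of_quotient_domain [Module.Finite R M] [Module.Finite R N]
    (hx : x ∈ IsLocalRing.maximalIdeal R) (hM : IsSMulRegular M x) {π : M →ₗ[R] C}
    (hfg : Function.Exact (LinearMap.lsmul R M x) π) (hπ : Function.Surjective π) {i : ℕ}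
    (h : ExtVanish R (i + 1) C N) : ExtVanish R i M N := by
  have hS := LinearMap.shortExact_of_exact (f := LinearMap.lsmul R M x) hM hfg hπ
  refine of_forall_exists_smul hx fun α ↦ ?_
  obtain ⟨β, rfl⟩ := Abelian.Ext.contravariant_sequence_exact₁ hS _ α (add_comm 1 i)
    (h.elim _ _)
  refine ⟨β, ?_⟩
  have : (ModuleCat.shortComplexOfCompEqZero (LinearMap.lsmul R M x) π
    hfg.linearMap_comp_eq_zero).f = x • 𝟙 (ModuleCat.of R M) := rfl
  rw [this, Abelian.Ext.mk₀_smul, Abelian.Ext.smul_comp, Abelian.Ext.mk₀_id_comp]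

/-- If `0 → N → N → C → 0` is exact with first map `x`, then vanishing of `Ext^i(M, C)`
forces that of `Ext^i(M, N)`. -/
lemma of_quotient_codomain [Module.Finite R M] [Module.Finite R N]
    (hx : x ∈ IsLocalRing.maximalIdeal R) (hN : IsSMulRegular N x) {π : N →ₗ[R] C}
    (hfg : Function.Exact (LinearMap.lsmul R N x) π) (hπ : Function.Surjective π) {i : ℕ}
    (h : ExtVanish R i M C) : ExtVanish R i M N := by
  have hS := LinearMap.shortExact_of_exact (f := LinearMap.lsmul R N x) hN hfg hπ
  refine of_forall_exists_smul hx fun α ↦ ?_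
  obtain ⟨β, rfl⟩ := Abelian.Ext.covariant_sequence_exact₂ _ hS α (h.elim _ _)
  refine ⟨β, ?_⟩
  have : (ModuleCat.shortComplexOfCompEqZero (LinearMap.lsmul R N x) π
    hfg.linearMap_comp_eq_zero).f = x • 𝟙 (ModuleCat.of R N) := rfl
  rw [this, Abelian.Ext.mk₀_smul, Abelian.Ext.comp_smul, Abelian.Ext.comp_mk₀_id]

end Local

end ExtVanish

end ExtVanishing

section TotallyReflexive

variable {R : Type u} [CommRing R]
variable {A B C : Type u} [AddCommGroup A] [Module R A] [AddCommGroup B] [Module R B]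
  [AddCommGroup C] [Module R C]

lemma totReflexive_iff (M : Type u) [AddCommGroup M] [Module R M] :
    TotReflexive R M ↔ Module.Finite R M ∧ Module.IsReflexive R M ∧
      (∀ i, ExtVanish R (i + 1) M R) ∧ ∀ i, ExtVanish R (i + 1) (Module.Dual R M) R := by
  have key (N : Type u) [AddCommGroup N] [Module R N] :
      (∀ i : ℕ, 1 ≤ i → Subsingleton (extMod R i N R)) ↔ ∀ i, ExtVanish R (i + 1) N R :=
    ⟨fun h i ↦ (extMod_succ_subsingleton_iff i N R).1 (h (i + 1) (by simp)), fun h i hi ↦ by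
      obtain ⟨j, rfl⟩ := Nat.exists_eq_add_of_le' hi
      exact (extMod_succ_subsingleton_iff j N R).2 (h j)⟩
  rw [TotReflexive, key, key]

lemma LinearMap.exists_comp_eq_of_ker_le {f : A →ₗ[R] B} {g : A →ₗ[R] C}
    (hf : Function.Surjective f) (h : LinearMap.ker f ≤ LinearMap.ker g) :
    ∃ φ : B →ₗ[R] C, φ ∘ₗ f = g := by
  refine ⟨(LinearMap.ker f).liftQ g h ∘ₗ (f.quotKerEquivOfSurjective hf).symm, ?_⟩
  ext a
  have : (f.quotKerEquivOfSurjective hf).symm (f a) = Submodule.Quotient.mk a := by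
    rw [LinearEquiv.symm_apply_eq]
    rfl
  simp [this]

lemma Module.Dual.exact_dualMap {f : A →ₗ[R] B} {g : B →ₗ[R] C}
    (hfg : Function.Exact f g) (hg : Function.Surjective g) :
    Function.Exact g.dualMap f.dualMap := by
  intro φ
  refine ⟨fun h ↦ ?_, ?_⟩
  · have hle : LinearMap.ker g ≤ LinearMap.ker φ := fun b hb ↦ by
      obtain ⟨a, rfl⟩ := (hfg b).1 hb
      exact LinearMap.congr_fun h a
    exact LinearMap.exists_comp_eq_of_ker_le hg hle
  · rintro ⟨ψ, rfl⟩
    ext a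
    simp [hfg.apply_apply_eq_zero]

lemma ExtVanish.dualMap_surjective {f : A →ₗ[R] B} {g : B →ₗ[R] C} (hf : Function.Injective f)
    (hfg : Function.Exact f g) (hg : Function.Surjective g) (hC : ExtVanish R 1 C R) :
    Function.Surjective f.dualMap :=
  fun φ ↦ ExtVanish.exists_extension hf hfg hg hC φ

lemma TotReflexive.isSMulRegular {M : Type u} [AddCommGroup M] [Module R M]
    (h : TotReflexive R M) {x : R} (hx : IsSMulRegular R x) : IsSMulRegular M x := by
  have := h.2.1
  refine isSMulRegular_iff_right_eq_zero_of_smul.2 fun m hm ↦ ?_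
  refine (Module.bijective_dual_eval R M).1 ?_
  rw [map_zero]
  ext φ
  refine hx.right_eq_zero_of_smul ?_
  exact (map_smul φ x m).symm.trans (by rw [hm, map_zero])

/-- Totally reflexive modules are closed under extensions. -/
lemma TotReflexive.middle {f : A →ₗ[R] B} {g : B →ₗ[R] C} (hf : Function.Injective f)
    (hfg : Function.Exact f g) (hg : Function.Surjective g)
    (hA : TotReflexive R A) (hC : TotReflexive R C) : TotReflexive R B := by
  rw [totReflexive_iff] at *
  obtain ⟨_, hA₁, hA₂, hA₃⟩ := hA
  obtain ⟨_, hC₁, hC₂, hC₃⟩ := hC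
  have hfg' := Module.Dual.exact_dualMap hfg hg
  have hf' := ExtVanish.dualMap_surjective hf hfg hg (hC₂ 0)
  have hg' := LinearMap.dualMap_injective_of_surjective hg
  have hfg'' := Module.Dual.exact_dualMap hfg' hf'
  have hg'' := ExtVanish.dualMap_surjective hg' hfg' hf' (hA₃ 0)
  have hf'' := LinearMap.dualMap_injective_of_surjective hf'
  refine ⟨?_, ⟨?_⟩, fun i ↦ .middle hf hfg hg (hA₂ i) (hC₂ i),
    fun i ↦ .middle hg' hfg' hf' (hC₃ i) (hA₃ i)⟩
  · exact Module.Finite.of_exact hfg hg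
  · refine ⟨(injective_iff_map_eq_zero _).2 fun b hb ↦ ?_, fun Φ ↦ ?_⟩
    · obtain ⟨a, rfl⟩ := (hfg b).1 <| (Module.bijective_dual_eval R C).1 <|
        (congrArg g.dualMap.dualMap hb).trans (by simp)
      have ha : f.dualMap.dualMap (Module.Dual.eval R A a) = f.dualMap.dualMap 0 :=
        hb.trans (map_zero _).symm
      rw [(Module.bijective_dual_eval R A).1 ((hf'' ha).trans (map_zero _).symm), map_zero]
    · obtain ⟨c, hc⟩ := (Module.bijective_dual_eval R C).2 (g.dualMap.dualMap Φ)
      obtain ⟨b, rfl⟩ := hg c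
      obtain ⟨Ψ, hΨ⟩ := (hfg'' (Φ - Module.Dual.eval R B b)).1 <| by
        rw [map_sub, ← hc]
        exact sub_self _
      obtain ⟨a, rfl⟩ := (Module.bijective_dual_eval R A).2 Ψ
      refine ⟨b + f a, ?_⟩
      rw [map_add, ← sub_add_cancel Φ (Module.Dual.eval R B b), ← hΨ, add_comm]
      rfl

/-- The cokernel of an injection of totally reflexive modules is totally reflexive as soon as its
`Ext`s against the ring vanish. -/
lemma TotReflexive.right {f : A →ₗ[R] B} {g : B →ₗ[R] C} (hf : Function.Injective f)
    (hfg : Function.Exact f g) (hg : Function.Surjective g)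
    (hA : TotReflexive R A) (hB : TotReflexive R B) (hC : ∀ i, ExtVanish R (i + 1) C R) :
    TotReflexive R C := by
  rw [totReflexive_iff] at *
  obtain ⟨_, hA₁, hA₂, hA₃⟩ := hA
  obtain ⟨_, hB₁, hB₂, hB₃⟩ := hB
  have hfg' := Module.Dual.exact_dualMap hfg hg
  have hf' := ExtVanish.dualMap_surjective hf hfg hg (hC 0)
  have hg' := LinearMap.dualMap_injective_of_surjective hg
  have hfg'' := Module.Dual.exact_dualMap hfg' hf'
  have hg'' := ExtVanish.dualMap_surjective hg' hfg' hf' (hA₃ 0)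
  refine ⟨Module.Finite.of_surjective g hg, ⟨?_⟩, hC,
    fun i ↦ .left hg' hfg' hf' (hB₃ i) (hA₃ (i + 1))⟩
  exact LinearMap.bijective_of_surjective_of_bijective_of_right_exact f g f.dualMap.dualMap
    g.dualMap.dualMap (Module.Dual.eval R A) (Module.Dual.eval R B) (Module.Dual.eval R C) rfl rfl
    hfg hfg'' (Module.bijective_dual_eval R A).2 (Module.bijective_dual_eval R B) hg hg''

end TotallyReflexive

section GorensteinDimension

variable {R : Type u} [CommRing R]

lemma GdimLE.of_shortExact {n : ℕ} {K G M : Type u} [AddCommGroup K] [Module R K]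
    [AddCommGroup G] [Module R G] [AddCommGroup M] [Module R M] {f : K →ₗ[R] G} {g : G →ₗ[R] M}
    (hf : Function.Injective f) (hfg : Function.Exact f g) (hg : Function.Surjective g)
    (hG : TotReflexive R G) (hK : GdimLE R n (ModuleCat.of R K)) :
    GdimLE R (n + 1) (ModuleCat.of R M) :=
  .succ n _ _ (ModuleCat.of R G) hG (ModuleCat.ofHom f) (ModuleCat.ofHom g) hf hfg hg hK

lemma GdimLE.extVanish {n : ℕ} {M : ModuleCat.{u} R} (h : GdimLE R n M) {i : ℕ} (hi : n < i) :
    ExtVanish R i M R := by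
  induction h generalizing i with
  | zero M h =>
    obtain ⟨j, rfl⟩ := Nat.exists_eq_add_of_le' hi
    exact ((totReflexive_iff M).1 h).2.2.1 j
  | succ n M K G hG f g hf hfg hg hK ih =>
    obtain ⟨j, rfl⟩ := Nat.exists_eq_add_of_le' hi
    exact .right (f := f.hom) (g := g.hom) hf hfg hg (ih (by lia))
      (((totReflexive_iff G).1 hG).2.2.1 _)

/-- If the Gorenstein dimension is finite, it is detected by vanishing of `Ext` into the ring. -/
lemma GdimLE.of_extVanish {n m : ℕ} {M : ModuleCat.{u} R} (h : GdimLE R n M) (hmn : m ≤ n)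
    (hM : ∀ i, m < i → ExtVanish R i M R) : GdimLE R m M := by
  induction h generalizing m with
  | zero M h =>
    obtain rfl : m = 0 := by lia
    exact .zero M h
  | succ n M K G hG f g hf hfg hg hK ih =>
    have hK' (i : ℕ) (hi : m ≤ i) (hi' : i ≠ 0) : ExtVanish R i K R := by
      obtain ⟨j, rfl⟩ := Nat.exists_eq_succ_of_ne_zero hi'
      exact .left (f := f.hom) (g := g.hom) hf hfg hg (((totReflexive_iff G).1 hG).2.2.1 j)
        (hM _ (by lia))
    cases m with
    | zero =>
      have hK₀ := ih (Nat.zero_le n) fun i hi ↦ hK' i hi.le hi.ne'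
      cases hK₀ with
      | zero _ hK₀ =>
      exact .zero M (.right (f := f.hom) (g := g.hom) hf hfg hg hK₀ hG fun i ↦ hM _ i.succ_pos)
    | succ m =>
      exact .succ m M K G hG f g hf hfg hg (ih (by lia) fun i hi ↦ hK' i (by lia) (by lia))

lemma gdim_le_natCast_iff {M : ModuleCat.{u} R} {n : ℕ} :
    gdim R M ≤ n ↔ ∃ k ≤ n, GdimLE R k M := by
  refine ⟨fun h ↦ ?_, fun ⟨k, hk, h⟩ ↦ le_trans (sInf_le ⟨k, rfl, h⟩) (Nat.cast_le.2 hk)⟩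
  have hne : {n : ℕ∞ | ∃ k : ℕ, n = (k : ℕ∞) ∧ GdimLE R k M}.Nonempty := by
    by_contra hne
    rw [Set.not_nonempty_iff_eq_empty] at hne
    rw [gdim, hne, sInf_empty] at h
    exact ENat.natCast_ne_top n (top_le_iff.1 h)
  obtain ⟨k, hk, h'⟩ := csInf_mem hne
  refine ⟨k, ?_, h'⟩
  rw [gdim, hk] at h
  exact_mod_cast h

lemma exists_gdimLE_of_gdim_ne_top {M : ModuleCat.{u} R} (h : gdim R M ≠ ⊤) :
    ∃ n, GdimLE R n M := by
  obtain ⟨n, hn⟩ := ENat.ne_top_iff_exists.1 h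
  obtain ⟨k, -, hk⟩ := gdim_le_natCast_iff.1 hn.symm.le
  exact ⟨k, hk⟩

lemma GdimLE.gdim_le_iff {n : ℕ} {M : ModuleCat.{u} R} (h : GdimLE R n M) {m : ℕ} :
    gdim R M ≤ m ↔ ∀ i, m < i → ExtVanish R i M R := by
  rw [gdim_le_natCast_iff]
  refine ⟨fun ⟨k, hk, hM⟩ i hi ↦ hM.extVanish (hk.trans_lt hi), fun hM ↦ ?_⟩
  obtain hmn | hnm := le_total m n
  · exact ⟨m, le_rfl, h.of_extVanish hmn hM⟩
  · exact ⟨n, hnm, h⟩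

lemma GdimLE.middle {n : ℕ} {G L N : Type u} [AddCommGroup G] [Module R G]
    [AddCommGroup L] [Module R L] [AddCommGroup N] [Module R N] {f : G →ₗ[R] L} {g : L →ₗ[R] N}
    (hf : Function.Injective f) (hfg : Function.Exact f g) (hg : Function.Surjective g)
    (hG : TotReflexive R G) (hN : GdimLE R n (ModuleCat.of R N)) :
    GdimLE R n (ModuleCat.of R L) := by
  cases hN with
  | zero _ hN => exact .zero _ (.middle hf hfg hg hG hN)
  | succ n _ K H hH j p hj hjp hp hK =>
    let P : Submodule R (L × H) := LinearMap.ker (g.coprod (-p.hom))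
    have hP (y : L × H) : y ∈ P ↔ g y.1 = p.hom y.2 := by
      simp [P, ← sub_eq_add_neg, sub_eq_zero]
    let a : G →ₗ[R] P := (LinearMap.inl R L H ∘ₗ f).codRestrict P fun x ↦ by
      simp [hP, hfg.apply_apply_eq_zero]
    let b : P →ₗ[R] H := LinearMap.snd R L H ∘ₗ P.subtype
    let c : K →ₗ[R] P := (LinearMap.inr R L H ∘ₗ j.hom).codRestrict P fun x ↦ by
      simpa [hP] using (hjp.apply_apply_eq_zero x).symm
    let d : P →ₗ[R] L := LinearMap.fst R L H ∘ₗ P.subtype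
    have hPr : TotReflexive R P := by
      refine .middle (f := a) (g := b) (fun x y h ↦ hf (congrArg (fun z ↦ z.1.1) h))
        (fun y ↦ ?_) (fun h ↦ ?_)
        hG hH
      · refine ⟨fun hy ↦ ?_, ?_⟩
        · have hy' := (hP _).1 y.2
          have hy₂ : y.1.2 = 0 := hy
          rw [hy₂, map_zero] at hy'
          obtain ⟨x, hx⟩ := (hfg _).1 hy'
          exact ⟨x, Subtype.ext (Prod.ext hx hy₂.symm)⟩
        · rintro ⟨x, rfl⟩
          rfl
      · obtain ⟨l, hl⟩ := hg (p.hom h)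
        exact ⟨⟨(l, h), (hP _).2 hl⟩, rfl⟩
    refine .of_shortExact (f := c) (g := d) (fun x y h ↦ hj (congrArg (fun z ↦ z.1.2) h))
      (fun y ↦ ?_)
      (fun l ↦ ?_) hPr hK
    · refine ⟨fun hy ↦ ?_, ?_⟩
      · have hy' := (hP _).1 y.2
        have hy₁ : y.1.1 = 0 := hy
        rw [hy₁, map_zero] at hy'
        obtain ⟨x, hx⟩ := (hjp _).1 hy'.symm
        exact ⟨x, Subtype.ext (Prod.ext hy₁.symm hx)⟩
      · rintro ⟨x, rfl⟩
        rfl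
    · obtain ⟨h, hh⟩ := hp (g l)
      exact ⟨⟨(l, h), (hP _).2 hh.symm⟩, rfl⟩

/-- `π : M → M'` exhibits `M'` as `M / xM`. -/
structure LinearMap.IsReduction (x : R) {M M' : Type u} [AddCommMonoid M] [Module R M]
    [AddCommMonoid M'] [Module R M'] (π : M →ₗ[R] M') : Prop where
  exact : Function.Exact (LinearMap.lsmul R M x) π
  surjective : Function.Surjective π

lemma Submodule.isReduction_mkQ (x : R) (M : Type u) [AddCommGroup M] [Module R M] :
    (Ideal.span {x} • (⊤ : Submodule R M)).mkQ.IsReduction x where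
  exact m := by
    simp [Submodule.ideal_span_singleton_smul, Submodule.mem_smul_pointwise_iff_exists]
  surjective := Submodule.mkQ_surjective _

lemma GdimLE.reduction {n : ℕ} {x : R} (hx : IsSMulRegular R x) {M : ModuleCat.{u} R}
    (h : GdimLE R n M) (hM : IsSMulRegular M x) {M' : Type u} [AddCommGroup M'] [Module R M']
    {π : M →ₗ[R] M'} (hπ : π.IsReduction x) : GdimLE R (n + 1) (ModuleCat.of R M') := by
  induction h generalizing M' with
  | zero M h =>
    exact .of_shortExact (f := LinearMap.lsmul R M x) hM hπ.exact hπ.surjective h (.zero _ h)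
  | succ n M K G hG f g hf hfg hg hK ih =>
    have hGx := hG.isSMulRegular hx
    let q : G →ₗ[R] M' := π ∘ₗ g.hom
    let L := LinearMap.ker q
    have hL (y : G) : y ∈ L ↔ ∃ m, x • m = g y := (hπ.exact (g y))
    let s : G →ₗ[R] L := (LinearMap.lsmul R G x).codRestrict L fun y ↦
      (hL _).2 ⟨g y, (map_smul g.hom x y).symm⟩
    let t : K →ₗ[R] L := f.hom.codRestrict L fun k ↦ (hL _).2 ⟨0, by
      rw [smul_zero]; exact (hfg.apply_apply_eq_zero k).symm⟩
    have hred : ((LinearMap.range s).mkQ ∘ₗ t).IsReduction x := by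
      refine ⟨fun k ↦ ?_, fun y ↦ ?_⟩
      · rw [LinearMap.comp_apply, Submodule.mkQ_apply, Submodule.Quotient.mk_eq_zero]
        refine ⟨fun ⟨y, hy⟩ ↦ ?_, ?_⟩
        · have hy' : x • y = f k := congrArg Subtype.val hy
          have hgy : g y = 0 := hM.right_eq_zero_of_smul <| by
            rw [← map_smul g.hom, hy']
            exact hfg.apply_apply_eq_zero k
          obtain ⟨k', rfl⟩ := (hfg y).1 hgy
          exact ⟨k', hf ((map_smul f.hom x k').trans hy')⟩
        · rintro ⟨k', rfl⟩
          exact ⟨f k', Subtype.ext (map_smul f.hom x k').symm⟩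
      · obtain ⟨l, rfl⟩ := Submodule.mkQ_surjective _ y
        obtain ⟨m, hm⟩ := (hL l).1 l.2
        obtain ⟨y, rfl⟩ := hg m
        obtain ⟨k, hk⟩ := (hfg (l.1 - x • y)).1 <| by
          rw [map_sub g.hom, map_smul g.hom]
          exact sub_eq_zero.2 hm.symm
        refine ⟨k, (Submodule.Quotient.eq _).2 ⟨-y, Subtype.ext ?_⟩⟩
        change x • -y = f k - l.1
        rw [hk]
        simp
    have hK' := ih (hGx.of_injective f.hom hf) hred
    have hL' : GdimLE R (n + 1) (ModuleCat.of R L) :=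
      .middle (f := s) (g := (LinearMap.range s).mkQ) (fun a b h ↦ hGx (congrArg Subtype.val h))
        (LinearMap.exact_map_mkQ_range s) (Submodule.mkQ_surjective _) hG hK'
    exact .of_shortExact (f := L.subtype) (g := q) L.subtype_injective
      (LinearMap.exact_subtype_ker_map q) (hπ.surjective.comp hg) hG hL'

end GorensteinDimension

section BaseChange

variable {R : Type u} [CommRing R] {x : R} {S : Type u} [CommRing S] [Algebra R S]

namespace LinearMap.IsReduction

section

variable {M M' : Type u} [AddCommGroup M] [Module R M] [AddCommGroup M'] [Module R M']
  {π : M →ₗ[R] M'}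

lemma apply_smul (hπ : π.IsReduction x) (m : M) : π (x • m) = 0 :=
  hπ.exact.apply_apply_eq_zero m

lemma apply_eq_zero (hπ : π.IsReduction x) {m : M} : π m = 0 ↔ ∃ m', x • m' = m :=
  hπ.exact m

/-- The kernel of the reduction of `g : P → M` is the reduction of the kernel of `g`. -/
lemma exists_ker {K P P' : Type u} [AddCommGroup K] [Module R K] [AddCommGroup P] [Module R P]
    [AddCommGroup P'] [Module R P'] [Module S P'] [IsScalarTower R S P'] [Module S M']
    (hM : IsSMulRegular M x) (hπ : π.IsReduction x)
    {ρ : P →ₗ[R] P'} (hρ : ρ.IsReduction x) {f : K →ₗ[R] P} {g : P →ₗ[R] M}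
    (hf : Function.Injective f) (hfg : Function.Exact f g) (hg : Function.Surjective g)
    {g' : P' →ₗ[S] M'} (hg' : ∀ p, g' (ρ p) = π (g p)) :
    ∃ κ : K →ₗ[R] LinearMap.ker g', κ.IsReduction x ∧ ∀ k, (κ k : P') = ρ (f k) := by
  let κ : K →ₗ[R] LinearMap.ker g' :=
    { toFun k := ⟨ρ (f k), by simp [hg', hfg.apply_apply_eq_zero]⟩
      map_add' a b := Subtype.ext (by simp)
      map_smul' r a := Subtype.ext (by simp) }
  refine ⟨κ, ⟨fun k ↦ ⟨fun hk ↦ ?_, ?_⟩, fun y ↦ ?_⟩, fun k ↦ rfl⟩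
  · obtain ⟨p, hp⟩ := hρ.apply_eq_zero.1 (congrArg Subtype.val hk : ρ (f k) = 0)
    have hgp : g p = 0 := hM.right_eq_zero_of_smul <| by
      rw [← map_smul, hp, hfg.apply_apply_eq_zero]
    obtain ⟨k', rfl⟩ := (hfg p).1 hgp
    exact ⟨k', hf ((map_smul f x k').trans hp)⟩
  · rintro ⟨k, rfl⟩
    refine Subtype.ext ?_
    change ρ (f (x • k)) = 0
    rw [map_smul, hρ.apply_smul]
  · obtain ⟨p, hp⟩ := hρ.surjective y.1
    obtain ⟨m, hm⟩ := hπ.apply_eq_zero.1 (show π (g p) = 0 by rw [← hg', hp]; exact y.2)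
    obtain ⟨q, rfl⟩ := hg m
    obtain ⟨k, hk⟩ := (hfg (p - x • q)).1 (by rw [map_sub, map_smul, hm, sub_self])
    refine ⟨k, Subtype.ext ?_⟩
    change ρ (f k) = y.1
    rw [hk, map_sub, hρ.apply_smul, sub_zero, hp]

end

variable {M M' N' : Type u} [AddCommGroup M] [Module R M]
  [AddCommGroup M'] [Module R M'] [Module S M'] [IsScalarTower R S M']
  [AddCommGroup N'] [Module R N'] [Module S N'] [IsScalarTower R S N'] {π : M →ₗ[R] M'}

lemma smul_eq_zero (hS : (Algebra.linearMap R S).IsReduction x) (n : N') : x • n = 0 := by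
  have : algebraMap R S x = 0 := by simpa using hS.apply_smul (1 : R)
  rw [← algebraMap_smul S x n, this, zero_smul]

lemma exists_descent (hS : (Algebra.linearMap R S).IsReduction x)
    (hπ : π.IsReduction x) (f : M →ₗ[R] N') :
    ∃ f' : M' →ₗ[S] N', ∀ m, f' (π m) = f m := by
  have hle : LinearMap.ker π ≤ LinearMap.ker f := fun m hm ↦ by
    obtain ⟨m, rfl⟩ := hπ.apply_eq_zero.1 hm
    rw [LinearMap.mem_ker, map_smul, smul_eq_zero hS]
  obtain ⟨f', hf'⟩ := LinearMap.exists_comp_eq_of_ker_le hπ.surjective hle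
  exact ⟨f'.extendScalarsOfSurjective hS.surjective, fun m ↦ LinearMap.congr_fun hf' m⟩

lemma finsupp (hS : (Algebra.linearMap R S).IsReduction x) (ι : Type u) :
    (Finsupp.mapRange.linearMap (Algebra.linearMap R S) : (ι →₀ R) →ₗ[R] ι →₀ S).IsReduction x where
  exact v := by
    classical
    refine ⟨fun hv ↦ ?_, ?_⟩
    · have (i : ι) : ∃ r, x • r = v i := hS.apply_eq_zero.1 (DFunLike.congr_fun hv i)
      choose r hr using this
      refine ⟨Finsupp.onFinset v.support (fun i ↦ if v i = 0 then 0 else r i) (by simp; tauto), ?_⟩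
      ext i
      by_cases hi : v i = 0
      · simp [hi]
      · simpa [hi] using hr i
    · rintro ⟨v, rfl⟩
      ext i
      exact hS.apply_smul (v i)
  surjective := Finsupp.mapRange_surjective _ (map_zero _) hS.surjective

section

variable {K K' P P' : Type u} [AddCommGroup K] [Module R K] [AddCommGroup K'] [Module R K']
  [Module S K'] [IsScalarTower R S K'] [AddCommGroup P] [Module R P] [AddCommGroup P']
  [Module R P'] [Module S P'] [IsScalarTower R S P'] {κ : K →ₗ[R] K'} {ρ : P →ₗ[R] P'}
  {f : K →ₗ[R] P} {g : P →ₗ[R] M} {f' : K' →ₗ[S] P'}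

lemma extVanish_one_iff {C : Type u} [AddCommGroup C] [Module S C] {g' : P' →ₗ[S] C}
    [Module.Projective R P] [Module.Projective S P']
    (hS : (Algebra.linearMap R S).IsReduction x)
    (hκ : κ.IsReduction x) (hρ : ρ.IsReduction x) (hf : Function.Injective f)
    (hfg : Function.Exact f g) (hg : Function.Surjective g) (hf' : Function.Injective f')
    (hfg' : Function.Exact f' g') (hg' : Function.Surjective g')
    (hκρ : ∀ k, f' (κ k) = ρ (f k)) : ExtVanish S 1 C N' ↔ ExtVanish R 1 M N' := by
  refine ⟨fun h ↦ .one_of_exists_extension hf hfg hg (.of_projective 0) fun φ ↦ ?_,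
    fun h ↦ .one_of_exists_extension hf' hfg' hg' (.of_projective 0) fun φ ↦ ?_⟩
  · obtain ⟨φ', hφ'⟩ := exists_descent hS hκ φ
    obtain ⟨ψ, hψ⟩ := ExtVanish.exists_extension hf' hfg' hg' h φ'
    refine ⟨ψ.restrictScalars R ∘ₗ ρ, LinearMap.ext fun k ↦ ?_⟩
    rw [← hφ', ← hψ]
    exact congrArg ψ (hκρ k).symm
  · obtain ⟨ψ, hψ⟩ := ExtVanish.exists_extension hf hfg hg h (φ.restrictScalars R ∘ₗ κ)
    obtain ⟨ψ', hψ'⟩ := exists_descent hS hρ ψ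
    refine ⟨ψ', LinearMap.ext fun y ↦ ?_⟩
    obtain ⟨k, rfl⟩ := hκ.surjective y
    exact (congrArg ψ' (hκρ k)).trans ((hψ' _).trans (LinearMap.congr_fun hψ k))

end

/-- A module and its reduction have compatible projective presentations. -/
lemma exists_presentation (hS : (Algebra.linearMap R S).IsReduction x)
    (hx : IsSMulRegular R x) (hπ : π.IsReduction x) (hM : IsSMulRegular M x) :
    ∃ (g : (M →₀ R) →ₗ[R] M) (g' : (M →₀ S) →ₗ[S] M')
      (ρ : (M →₀ R) →ₗ[R] (M →₀ S)) (κ : LinearMap.ker g →ₗ[R] LinearMap.ker g'),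
      Function.Surjective g ∧ Function.Surjective g' ∧ ρ.IsReduction x ∧ κ.IsReduction x ∧
      IsSMulRegular (LinearMap.ker g) x ∧ ∀ k, (κ k : M →₀ S) = ρ k := by
  let g : (M →₀ R) →ₗ[R] M := Finsupp.linearCombination R (_root_.id : M → M)
  have hg : Function.Surjective g := Finsupp.linearCombination_id_surjective R M
  let g' : (M →₀ S) →ₗ[S] M' := Finsupp.linearCombination S π
  have hρ := finsupp hS M
  set ρ : (M →₀ R) →ₗ[R] (M →₀ S) := Finsupp.mapRange.linearMap (Algebra.linearMap R S)
  have hgg' (p) : g' (ρ p) = π (g p) := by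
    have : g'.restrictScalars R ∘ₗ ρ = π ∘ₗ g := by
      ext m
      simp [g, g', ρ]
    exact LinearMap.congr_fun this p
  have hg' : Function.Surjective g' := fun y ↦ by
    obtain ⟨m, rfl⟩ := hπ.surjective y
    exact ⟨Finsupp.single m 1, by simp [g']⟩
  have hP : IsSMulRegular (M →₀ R) x := fun v w h ↦ by
    ext i
    exact hx (DFunLike.congr_fun h i)
  obtain ⟨κ, hκ, hκρ⟩ := exists_ker (K := LinearMap.ker g) hM hπ hρ
    (Submodule.subtype_injective _) (LinearMap.exact_subtype_ker_map g) hg hgg'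
  exact ⟨g, g', ρ, κ, hg, hg', hρ, hκ, hP.of_injective _ (Submodule.subtype_injective _), hκρ⟩

/-- Change of rings: `Ext_S(M/xM, N') = Ext_R(M, N')`, for vanishing in positive degrees. -/
lemma extVanish_iff (hS : (Algebra.linearMap R S).IsReduction x)
    (hx : IsSMulRegular R x) (hπ : π.IsReduction x) (hM : IsSMulRegular M x)
    (i : ℕ) : ExtVanish S (i + 1) M' N' ↔ ExtVanish R (i + 1) M N' := by
  induction i generalizing M M' with
  | zero =>
    obtain ⟨g, g', ρ, κ, hg, hg', hρ, hκ, -, hκρ⟩ := exists_presentation hS hx hπ hM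
    exact extVanish_one_iff (K := LinearMap.ker g) (K' := LinearMap.ker g')
      (f' := (LinearMap.ker g').subtype) hS hκ hρ (LinearMap.ker g).subtype_injective
      (LinearMap.exact_subtype_ker_map g) hg (LinearMap.ker g').subtype_injective
      (LinearMap.exact_subtype_ker_map g') hg' hκρ
  | succ i ih =>
    obtain ⟨g, g', -, κ, hg, hg', -, hκ, hK, -⟩ := exists_presentation hS hx hπ hM
    refine Iff.trans ?_ ((ih (M := LinearMap.ker g) (M' := LinearMap.ker g') hκ hK).trans ?_)
    · have hf' := (LinearMap.ker g').subtype_injective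
      have hfg' := LinearMap.exact_subtype_ker_map g'
      exact ⟨fun h ↦ .left hf' hfg' hg' (.of_projective i) h,
        fun h ↦ .right hf' hfg' hg' h (.of_projective _)⟩
    · have hf := (LinearMap.ker g).subtype_injective
      have hfg := LinearMap.exact_subtype_ker_map g
      exact ⟨fun h ↦ .right hf hfg hg h (.of_projective _),
        fun h ↦ .left hf hfg hg (.of_projective i) h⟩

end LinearMap.IsReduction

end BaseChange

section Reduction

variable {R : Type u} [CommRing R] {x : R}

namespace LinearMap.IsReduction

variable {S : Type u} [CommRing S] [Algebra R S] {M M' : Type u} [AddCommGroup M] [Module R M]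
  [AddCommGroup M'] [Module R M'] [Module S M'] [IsScalarTower R S M'] {π : M →ₗ[R] M'}

/-- Duality commutes with reduction modulo `x`. -/
lemma exists_dual (hS : (Algebra.linearMap R S).IsReduction x) (hx : IsSMulRegular R x)
    (hπ : π.IsReduction x) (hM : ExtVanish R 1 M R) :
    ∃ ρ : Module.Dual R M →ₗ[R] Module.Dual S M', ρ.IsReduction x ∧
      ∀ φ m, ρ φ (π m) = algebraMap R S (φ m) := by
  choose F hF using fun φ : Module.Dual R M ↦ exists_descent hS hπ (Algebra.linearMap R S ∘ₗ φ)
  have hext {α β : Module.Dual S M'} (h : ∀ m, α (π m) = β (π m)) : α = β :=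
    LinearMap.ext fun y ↦ by
      obtain ⟨m, rfl⟩ := hπ.surjective y
      exact h m
  let ρ : Module.Dual R M →ₗ[R] Module.Dual S M' :=
    { toFun := F
      map_add' φ ψ := hext fun m ↦ by simp [hF]
      map_smul' r φ := hext fun m ↦ by simp [hF, Algebra.smul_def] }
  refine ⟨ρ, ⟨fun φ ↦ ⟨fun hφ ↦ ?_, ?_⟩, fun ψ ↦ ?_⟩, hF⟩
  · have (m : M) : ∃ r, x • r = φ m := hS.apply_eq_zero.1 <|
      (hF φ m).symm.trans (LinearMap.congr_fun hφ (π m))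
    choose φ' hφ' using this
    refine ⟨⟨⟨φ', fun m n ↦ hx ?_⟩, fun r m ↦ hx ?_⟩, LinearMap.ext hφ'⟩
    · simp only [smul_add, hφ', map_add]
    · simp only [hφ', map_smul, RingHom.id_apply, smul_comm x r]
  · rintro ⟨φ, rfl⟩
    exact hext fun m ↦ (hF _ m).trans (hS.apply_smul (φ m))
  · obtain ⟨φ, hφ⟩ := ExtVanish.exists_lift (f := LinearMap.lsmul R R x) hx hS.exact hS.surjective
      hM (ψ.restrictScalars R ∘ₗ π)
    exact ⟨φ, hext fun m ↦ (hF φ m).trans (LinearMap.congr_fun hφ m)⟩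

lemma extVanish_of_extVanish_succ (hS : (Algebra.linearMap R S).IsReduction x)
    (hx : IsSMulRegular R x) (hπ : π.IsReduction x) (hM : IsSMulRegular M x) {i : ℕ}
    (h : ExtVanish R (i + 1) M R) (h' : ExtVanish R (i + 2) M R) : ExtVanish S (i + 1) M' S :=
  (extVanish_iff hS hx hπ hM i).2 <|
    .codomain_right (f := LinearMap.lsmul R R x) hx hS.exact hS.surjective h h'

lemma totReflexive (hS : (Algebra.linearMap R S).IsReduction x) (hx : IsSMulRegular R x)
    (hπ : π.IsReduction x) (h : TotReflexive R M) : TotReflexive S M' := by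
  have hM := h.isSMulRegular hx
  rw [totReflexive_iff] at *
  obtain ⟨_, hM₁, hM₂, hM₃⟩ := h
  obtain ⟨ρ, hρ, hρπ⟩ := exists_dual hS hx hπ (hM₂ 0)
  obtain ⟨σ, hσ, hσρ⟩ := exists_dual hS hx hρ (hM₃ 0)
  have hD : IsSMulRegular (Module.Dual R M) x := fun φ ψ h ↦
    LinearMap.ext fun m ↦ hx (LinearMap.congr_fun h m)
  have hev (m : M) : σ (Module.Dual.eval R M m) = Module.Dual.eval S M' (π m) := by
    refine LinearMap.ext fun ψ ↦ ?_
    obtain ⟨φ, rfl⟩ := hρ.surjective ψ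
    rw [hσρ, Module.Dual.eval_apply, Module.Dual.eval_apply, hρπ]
  refine ⟨?_, ⟨(injective_iff_map_eq_zero _).2 fun y hy ↦ ?_, fun Ψ ↦ ?_⟩,
    fun i ↦ extVanish_of_extVanish_succ hS hx hπ hM (hM₂ i) (hM₂ (i + 1)),
    fun i ↦ extVanish_of_extVanish_succ hS hx hρ hD (hM₃ i) (hM₃ (i + 1))⟩
  · have := Module.Finite.of_surjective π hπ.surjective
    exact Module.Finite.of_restrictScalars_finite R S M'
  · obtain ⟨m, rfl⟩ := hπ.surjective y
    obtain ⟨Φ, hΦ⟩ := hσ.apply_eq_zero.1 ((hev m).trans hy)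
    obtain ⟨m', rfl⟩ := (Module.bijective_dual_eval R M).2 Φ
    rw [← map_smul] at hΦ
    rw [← (Module.bijective_dual_eval R M).1 hΦ, hπ.apply_smul]
  · obtain ⟨Φ, rfl⟩ := hσ.surjective Ψ
    obtain ⟨m, rfl⟩ := (Module.bijective_dual_eval R M).2 Φ
    exact ⟨π m, (hev m).symm⟩

end LinearMap.IsReduction

lemma Ideal.Quotient.isReduction_algebraMap (x : R) :
    (Algebra.linearMap R (R ⧸ Ideal.span {x})).IsReduction x where
  exact r := by
    simp [Ideal.Quotient.eq_zero_iff_mem, Ideal.mem_span_singleton', mul_comm]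
  surjective := Ideal.Quotient.mk_surjective

lemma GdimLE.quotient {n : ℕ} (hx : IsSMulRegular R x) {M : ModuleCat.{u} R}
    (h : GdimLE R n M) (hM : IsSMulRegular M x) {M' : Type u} [AddCommGroup M'] [Module R M']
    [Module (R ⧸ Ideal.span {x}) M'] [IsScalarTower R (R ⧸ Ideal.span {x}) M']
    {π : M →ₗ[R] M'} (hπ : π.IsReduction x) :
    GdimLE (R ⧸ Ideal.span {x}) n (ModuleCat.of (R ⧸ Ideal.span {x}) M') := by
  have hS := Ideal.Quotient.isReduction_algebraMap x
  induction h generalizing M' with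
  | zero M h => exact .zero _ (LinearMap.IsReduction.totReflexive hS hx hπ h)
  | succ n M K G hG f g hf hfg hg hK ih =>
    have hρ := Submodule.isReduction_mkQ x G
    obtain ⟨g', hg'⟩ := LinearMap.IsReduction.exists_descent hS hρ (π ∘ₗ g.hom)
    obtain ⟨κ, hκ, -⟩ := LinearMap.IsReduction.exists_ker (f := f.hom) (g := g.hom) hM hπ hρ hf hfg
      hg hg'
    refine .of_shortExact (LinearMap.ker g').subtype_injective
      (LinearMap.exact_subtype_ker_map g') (fun y ↦ ?_)
      (LinearMap.IsReduction.totReflexive hS hx hρ hG)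
      (ih ((hG.isSMulRegular hx).of_injective f.hom hf) hκ)
    obtain ⟨m, rfl⟩ := hπ.surjective y
    obtain ⟨p, rfl⟩ := hg m
    exact ⟨_, hg' p⟩

end Reduction

lemma ENat.eq_of_forall_le_natCast_iff {a b : ℕ∞} (h : ∀ n : ℕ, a ≤ n ↔ b ≤ n) : a = b := by
  refine le_antisymm ?_ ?_
  · induction b with
    | top => exact le_top
    | coe n => exact (h n).2 le_rfl
  · induction a with
    | top => exact le_top
    | coe n => exact (h n).1 le_rfl

/-- for `x ∈ m` regular on `R` and `M`, with `G-dim_R M < ∞`: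
`G-dim_R (M/xM) = G-dim_R M + 1` and `G-dim_{R/xR} (M/xM) = G-dim_R M`. -/
theorem stmt_12 (R : Type u) [CommRing R] [IsNoetherianRing R] [IsLocalRing R]
    (M : Type u) [AddCommGroup M] [Module R M] [Module.Finite R M] [Nontrivial M]
    (hfin : gdim R (ModuleCat.of R M) ≠ ⊤)
    (x : R) (hx : x ∈ IsLocalRing.maximalIdeal R)
    (hxR : IsSMulRegular R x) (hxM : IsSMulRegular M x) :
    gdim R (ModuleCat.of R (M ⧸ (Ideal.span {x} • ⊤ : Submodule R M))) =
        gdim R (ModuleCat.of R M) + 1 ∧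
      gdim (R ⧸ Ideal.span {x})
          (ModuleCat.of (R ⧸ Ideal.span {x}) (M ⧸ (Ideal.span {x} • ⊤ : Submodule R M))) =
        gdim R (ModuleCat.of R M) := by
  have hS := Ideal.Quotient.isReduction_algebraMap x
  have hπ := Submodule.isReduction_mkQ x M
  obtain ⟨n, hn⟩ := exists_gdimLE_of_gdim_ne_top hfin
  have hn₁ := hn.reduction hxR hxM hπ
  have hn₂ := hn.quotient hxR hxM hπ
  constructor
  · refine ENat.eq_of_forall_le_natCast_iff fun m ↦ ?_
    cases m with
    | zero =>
      refine iff_of_false (fun h ↦ ?_) (by simp)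
      obtain ⟨k, hk, h'⟩ := gdim_le_natCast_iff.1 h
      obtain rfl := Nat.le_zero.1 hk
      obtain ⟨_, h'⟩ := h'
      have hreg : IsSMulRegular (M ⧸ (Ideal.span {x} • ⊤ : Submodule R M)) x :=
        h'.isSMulRegular hxR
      have htop : (Ideal.span {x} • ⊤ : Submodule R M) = ⊤ := by
        refine eq_top_iff.2 fun m _ ↦ ?_
        rw [← Submodule.Quotient.mk_eq_zero]
        refine hreg.right_eq_zero_of_smul ?_
        exact (map_smul (Submodule.mkQ _) x m).symm.trans (hπ.apply_smul m)
      refine top_ne_bot (α := Submodule R M) <|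
        Submodule.eq_bot_of_le_smul_of_le_jacobson_bot (Ideal.span {x}) ⊤ Module.Finite.fg_top
          htop.ge ?_
      rw [Ideal.span_singleton_le_iff_mem, IsLocalRing.jacobson_eq_maximalIdeal _ bot_ne_top]
      exact hx
    | succ m =>
      rw [hn₁.gdim_le_iff, Nat.cast_succ, ENat.add_le_add_iff_right ENat.one_ne_top,
        hn.gdim_le_iff]
      refine ⟨fun h i hi ↦ .of_quotient_domain hx hxM hπ.exact hπ.surjective (h _ (by lia)),
        fun h i hi ↦ ?_⟩
      obtain ⟨j, rfl⟩ := Nat.exists_eq_add_of_le' (show 1 ≤ i by lia)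
      exact .right (f := LinearMap.lsmul R M x) hxM hπ.exact hπ.surjective (h _ (by lia))
        (h _ (by lia))
  · refine ENat.eq_of_forall_le_natCast_iff fun m ↦ ?_
    rw [hn₂.gdim_le_iff, hn.gdim_le_iff]
    refine ⟨fun h i hi ↦ ?_, fun h i hi ↦ ?_⟩
    all_goals obtain ⟨j, rfl⟩ := Nat.exists_eq_add_of_le' (show 1 ≤ i by lia)
    · exact .of_quotient_codomain hx hxR hS.exact hS.surjective
        ((LinearMap.IsReduction.extVanish_iff hS hxR hπ hxM j).1 (h _ hi))
    · exact LinearMap.IsReduction.extVanish_of_extVanish_succ hS hxR hπ hxM (h _ hi)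
        (h _ (by lia))
end
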